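/- arXiv:0810.0654 — 2 statements merged into one kernel-verified Lean document; each statement's English description precedes it below -/
import Mathlib

section
/- Assume condition (L): p > 2, or p < 2 and α < δ, and assume α < N. Set a̲ = (N-α)^{1/(q-1)}. Then for any a ∈ (0, a̲], the global solution w(·,a) satisfies w(r,a) > 0 for all r ∈ [0,∞) and L(a) = lim_{r→∞} r^α w(r,a) > 0. -/
open Set Filter Topology Asymptotics

/-- The p-Laplacian nonlinearity φ_p(x) = |x|^{p-2} x. -/
noncomputable def phiP (p x : ℝ) : ℝ := |x| ^ (p - 2) * x

/-- `w` is a solution of equation (E) on the interval `I ⊆ (0,∞)`: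
`w` is C¹ on `I`, `|w'|^{p-2} w'` is C¹ on `I`, and the equation
`(|w'|^{p-2}w')' + ((N-1)/r)|w'|^{p-2}w' + r w' + α w + |w|^{q-1} w = 0`
holds on `I` (derivatives taken within `I`). -/
def IsSolutionOn (N : ℕ) (p q α : ℝ) (w : ℝ → ℝ) (I : Set ℝ) : Prop :=
  ContDiffOn ℝ 1 w I ∧
  ContDiffOn ℝ 1 (fun r => phiP p (derivWithin w I r)) I ∧
  ∀ r ∈ I,
    derivWithin (fun s => phiP p (derivWithin w I s)) I r
      + ((N : ℝ) - 1) / r * phiP p (derivWithin w I r)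
      + r * derivWithin w I r + α * w r + |w r| ^ (q - 1) * w r = 0

/-- `w` is the global solution of (E) on `[0,∞)` with `w(0) = a`, `w'(0) = 0`:
`w ∈ C¹([0,∞))`, `|w'|^{p-2}w' ∈ C¹([0,∞))`, and (E) holds on `(0,∞)`. -/
def IsGlobalSolution (N : ℕ) (p q α a : ℝ) (w : ℝ → ℝ) : Prop :=
  ContDiffOn ℝ 1 w (Ici 0) ∧
  ContDiffOn ℝ 1 (fun r => phiP p (derivWithin w (Ici 0) r)) (Ici 0) ∧
  (∀ r ∈ Ioi (0 : ℝ),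
    derivWithin (fun s => phiP p (derivWithin w (Ici 0) s)) (Ici 0) r
      + ((N : ℝ) - 1) / r * phiP p (derivWithin w (Ici 0) r)
      + r * derivWithin w (Ici 0) r + α * w r + |w r| ^ (q - 1) * w r = 0) ∧
  w 0 = a ∧ derivWithin w (Ici 0) 0 = 0

/-- `r` is an isolated zero of `w` relative to the set `I`. -/
def IsIsolatedZeroOn (w : ℝ → ℝ) (I : Set ℝ) (r : ℝ) : Prop :=
  r ∈ I ∧ w r = 0 ∧ ∀ᶠ s in 𝓝[I \ {r}] r, w s ≠ 0

/-- `w` has at least `n` isolated zeros in `(0,∞)`. -/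
def HasAtLeastIsolatedZeros (w : ℝ → ℝ) (n : ℕ) : Prop :=
  ∃ z : Fin n → ℝ, StrictMono z ∧ ∀ i, 0 < z i ∧ IsIsolatedZeroOn w (Ici 0) (z i)

theorem phiP_nonneg_iff {p x : ℝ} : 0 ≤ phiP p x ↔ 0 ≤ x := by
  unfold phiP
  rcases eq_or_ne x 0 with rfl | hx
  · simp
  · exact mul_nonneg_iff_of_pos_left (Real.rpow_pos_of_pos (abs_pos.2 hx) _)

/-- A profile `(w, w')` of equation (E) with sign and regularity data unpacked pointwise. -/
structure IsProfile (n p q α a : ℝ) (w d : ℝ → ℝ) : Prop where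
  contW : ContinuousOn w (Ici 0)
  contP : ContinuousOn (fun r => phiP p (d r)) (Ici 0)
  w_zero : w 0 = a
  d_zero : d 0 = 0
  derivW : ∀ r, 0 < r → HasDerivAt w (d r) r
  derivP : ∀ r, 0 < r → HasDerivAt (fun r => phiP p (d r))
    (-((n - 1) / r * phiP p (d r)) - r * d r - α * w r - |w r| ^ (q - 1) * w r) r

theorem IsGlobalSolution.isProfile {N : ℕ} {p q α a : ℝ} {w : ℝ → ℝ}
    (hw : IsGlobalSolution N p q α a w) :
    IsProfile N p q α a w (derivWithin w (Ici 0)) := by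
  obtain ⟨h1, h2, h3, h4, h5⟩ := hw
  have key : ∀ f : ℝ → ℝ, ContDiffOn ℝ 1 f (Ici 0) → ∀ r, 0 < r →
      HasDerivAt f (derivWithin f (Ici 0) r) r := fun f hf r hr =>
    ((hf.differentiableOn one_ne_zero) r hr.le).hasDerivWithinAt.hasDerivAt (Ici_mem_nhds hr)
  refine ⟨h1.continuousOn, h2.continuousOn, h4, h5, key w h1, fun r hr => ?_⟩
  convert key _ h2 r hr using 1
  linarith [h3 r hr]

theorem exists_lt_of_hasDerivAt_neg {f : ℝ → ℝ} {f' x : ℝ} (hf : HasDerivAt f f' x)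
    (hneg : f' < 0) (hx : 0 < x) : ∃ y ∈ Ioo 0 x, f x < f y := by
  have h1 : ∀ᶠ y in 𝓝[<] x, slope f x y < 0 :=
    ((hasDerivAt_iff_tendsto_slope.1 hf).mono_left
      (nhdsWithin_mono _ fun y hy => ne_of_lt hy)).eventually (gt_mem_nhds hneg)
  obtain ⟨y, hy, hy'⟩ := (h1.and (Ioo_mem_nhdsLT hx)).exists
  refine ⟨y, hy', ?_⟩
  rw [slope_def_field, div_neg_iff] at hy
  rcases hy with hy | hy <;> linarith [hy'.2]

namespace IsProfile

variable {n p q α a : ℝ} {w d : ℝ → ℝ}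

theorem phiP_zero (h : IsProfile n p q α a w d) : phiP p (d 0) = 0 := by
  simp [h.d_zero, phiP]

/-- As long as `w` stays positive, it is strictly decreasing. -/
theorem phiP_neg (h : IsProfile n p q α a w d) (hn : 1 ≤ n) (hα : 0 < α) {R : ℝ}
    (hpos : ∀ r ∈ Ico 0 R, 0 < w r) : ∀ r ∈ Ioo 0 R, phiP p (d r) < 0 := by
  intro r hr
  by_contra! hcon
  obtain ⟨x, hx, hmax⟩ := isCompact_Icc.exists_isMaxOn (nonempty_Icc.2 hr.1.le)
    (h.contP.mono (Icc_subset_Ici_self : Icc 0 r ⊆ Ici 0))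
  obtain ⟨x, hx, hx0, hmax⟩ : ∃ x ∈ Icc 0 r, 0 < x ∧
      IsMaxOn (fun r => phiP p (d r)) (Icc 0 r) x := by
    rcases hx.1.eq_or_lt with rfl | h0
    · refine ⟨r, right_mem_Icc.2 hr.1.le, hr.1, fun y hy => ?_⟩
      have := hmax hy
      simp only [mem_ofPred_eq, h.phiP_zero] at this ⊢
      linarith
    · exact ⟨x, hx, h0, hmax⟩
  have hP : 0 ≤ phiP p (d x) := by
    have := hmax (left_mem_Icc.2 hr.1.le)
    simpa [h.phiP_zero] using this
  have hd : 0 ≤ d x := phiP_nonneg_iff.1 hP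
  have hwx := hpos x ⟨hx0.le, hx.2.trans_lt hr.2⟩
  obtain ⟨y, hy, hlt⟩ := exists_lt_of_hasDerivAt_neg (h.derivP x hx0) (by
    have h1 : 0 ≤ (n - 1) / x * phiP p (d x) :=
      mul_nonneg (div_nonneg (by linarith) hx0.le) hP
    have h2 : 0 ≤ x * d x := mul_nonneg hx0.le hd
    have h3 : 0 < α * w x := mul_pos hα hwx
    have h4 : 0 ≤ |w x| ^ (q - 1) * w x := by positivity
    linarith) hx0
  exact absurd (hmax ⟨hy.1.le, hy.2.le.trans hx.2⟩) (not_le.2 hlt)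

theorem d_neg (h : IsProfile n p q α a w d) (hn : 1 ≤ n) (hα : 0 < α) {R : ℝ}
    (hpos : ∀ r ∈ Ico 0 R, 0 < w r) {r : ℝ} (hr : r ∈ Ioo 0 R) : d r < 0 :=
  not_le.1 fun hc => absurd (phiP_nonneg_iff.2 hc) (not_le.2 (h.phiP_neg hn hα hpos r hr))

theorem lt_initial (h : IsProfile n p q α a w d) (hn : 1 ≤ n) (hα : 0 < α) {R : ℝ}
    (hpos : ∀ r ∈ Ico 0 R, 0 < w r) {r : ℝ} (hr : r ∈ Ioo 0 R) : w r < a := by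
  have : StrictAntiOn w (Icc 0 r) := by
    refine strictAntiOn_of_deriv_neg (convex_Icc _ _)
      (h.contW.mono Icc_subset_Ici_self) fun x hx => ?_
    rw [interior_Icc] at hx
    rw [(h.derivW x hx.1).deriv]
    exact h.d_neg hn hα hpos ⟨hx.1, hx.2.trans hr.2⟩
  simpa [h.w_zero] using this (left_mem_Icc.2 hr.1.le) (right_mem_Icc.2 hr.1.le) hr.1

/-- The weighted quantity `r ^ (n - 1) * P + r ^ n * w` is positive while `w` is. -/
theorem phiP_add_mul_pos {m : ℕ} (h : IsProfile (m + 1 : ℝ) p q α a w d) (hα : 0 < α)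
    (hq : 1 < q) (haN : a ^ (q - 1) ≤ m + 1 - α) {R : ℝ} (hR : 0 < R)
    (hpos : ∀ r ∈ Ico 0 R, 0 < w r) : 0 < phiP p (d R) + R * w R := by
  have hn : (1 : ℝ) ≤ m + 1 := by linarith [(Nat.cast_nonneg m : (0 : ℝ) ≤ m)]
  have hmono : StrictMonoOn (fun r => r ^ m * phiP p (d r) + r ^ (m + 1) * w r) (Icc 0 R) := by
    refine strictMonoOn_of_deriv_pos (convex_Icc _ _) ?_ fun x hx => ?_
    · have h1 := h.contP.mono (Icc_subset_Ici_self : Icc 0 R ⊆ Ici 0)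
      have h2 := h.contW.mono (Icc_subset_Ici_self : Icc 0 R ⊆ Ici 0)
      exact ((continuous_pow m).continuousOn.mul h1).add
        ((continuous_pow (m + 1)).continuousOn.mul h2)
    · rw [interior_Icc] at hx
      have hw0 := hpos x ⟨hx.1.le, hx.2⟩
      have hD := ((hasDerivAt_pow m x).fun_mul (h.derivP x hx.1)).fun_add
        ((hasDerivAt_pow (m + 1) x).fun_mul (h.derivW x hx.1))
      have hlt : w x ^ (q - 1) < m + 1 - α :=
        (Real.rpow_lt_rpow hw0.le (h.lt_initial hn hα hpos hx) (by linarith)).trans_le haN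
      have hx1 := hx.1
      have : 0 < x ^ m * w x * (m + 1 - α - w x ^ (q - 1)) :=
        mul_pos (mul_pos (pow_pos hx.1 m) hw0) (by linarith)
      rw [hD.deriv]
      convert this using 1
      rw [abs_of_pos hw0]
      have e : (m : ℝ) * x ^ (m - 1) = m * x ^ m / x := by
        rcases m with _ | m
        · simp
        · field_simp
          simp [pow_succ]
      rw [e]
      push_cast
      field_simp
      ring
  have := hmono (left_mem_Icc.2 hR.le) (right_mem_Icc.2 hR.le) hR
  simp only [h.phiP_zero, mul_zero, zero_add, pow_succ, zero_mul] at this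
  have e : R ^ m * phiP p (d R) + R ^ m * R * w R = R ^ m * (phiP p (d R) + R * w R) := by ring
  rw [e] at this
  exact pos_of_mul_pos_right this (by positivity)

theorem pos {m : ℕ} (h : IsProfile (m + 1 : ℝ) p q α a w d) (hα : 0 < α)
    (hq : 1 < q) (ha : 0 < a) (haN : a ^ (q - 1) ≤ m + 1 - α) : ∀ r, 0 ≤ r → 0 < w r := by
  have hn : (1 : ℝ) ≤ m + 1 := by linarith [(Nat.cast_nonneg m : (0 : ℝ) ≤ m)]
  intro r hr
  by_contra! hcon
  have hcont := h.contW.mono (Icc_subset_Ici_self : Icc 0 r ⊆ Ici 0)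
  have hcomp : IsCompact (Icc 0 r ∩ w ⁻¹' Iic 0) :=
    isCompact_Icc.of_isClosed_subset (hcont.preimage_isClosed_of_isClosed isClosed_Icc isClosed_Iic)
      inter_subset_left
  obtain ⟨R, ⟨hR, hwR⟩, hmin⟩ := hcomp.exists_isLeast ⟨r, right_mem_Icc.2 hr, hcon⟩
  simp only [mem_preimage, mem_Iic] at hwR
  have hR0 : 0 < R := by
    refine hR.1.lt_of_ne' fun e => ?_
    rw [e, h.w_zero] at hwR
    linarith
  have hpos : ∀ s ∈ Ico 0 R, 0 < w s := fun s hs => by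
    by_contra! hc
    exact absurd (hmin ⟨⟨hs.1, hs.2.le.trans hR.2⟩, hc⟩) (not_le.2 hs.2)
  have hPR : phiP p (d R) ≤ 0 := by
    have hc : ContinuousAt (fun r => phiP p (d r)) R := (h.derivP R hR0).continuousAt
    refine le_of_tendsto (hc.tendsto.mono_left (nhdsWithin_le_nhds (s := Iio R))) ?_
    filter_upwards [Ioo_mem_nhdsLT hR0] with s hs using (h.phiP_neg hn hα hpos s hs).le
  have := h.phiP_add_mul_pos hα hq haN hR0 hpos
  nlinarith [mul_nonneg hR0.le (neg_nonneg.2 hwR)]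

end IsProfile

theorem monotoneOn_Ici_of_hasDerivAt {f f' : ℝ → ℝ} {R : ℝ}
    (hf : ∀ x, R ≤ x → HasDerivAt f (f' x) x) (hf' : ∀ x, R ≤ x → 0 ≤ f' x) :
    MonotoneOn f (Ici R) := by
  refine monotoneOn_of_deriv_nonneg (convex_Ici R)
    (fun x hx => (hf x hx).continuousAt.continuousWithinAt)
    (fun x hx => (hf x (interior_subset hx)).differentiableAt.differentiableWithinAt)
    fun x hx => ?_
  rw [(hf x (interior_subset hx)).deriv]
  exact hf' x (interior_subset hx)

theorem antitoneOn_Ici_of_hasDerivAt {f f' : ℝ → ℝ} {R : ℝ}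
    (hf : ∀ x, R ≤ x → HasDerivAt f (f' x) x) (hf' : ∀ x, R ≤ x → f' x ≤ 0) :
    AntitoneOn f (Ici R) := by
  have := monotoneOn_Ici_of_hasDerivAt (f := fun x => -f x) (f' := fun x => -f' x)
    (fun x hx => (hf x hx).fun_neg) (fun x hx => by linarith [hf' x hx])
  exact fun x hx y hy hxy => neg_le_neg_iff.1 (this hx hy hxy)

/-- A differentiable function that meets the barrier `B` only while going down relative to it
stays below `B` once it is below. -/
theorem le_barrier_of_deriv_lt {f f' B B' : ℝ → ℝ} {R : ℝ}
    (hf : ∀ x, R ≤ x → HasDerivAt f (f' x) x) (hB : ∀ x, R ≤ x → HasDerivAt B (B' x) x)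
    (h : ∀ x, R ≤ x → f x = B x → f' x < B' x) (hR : f R ≤ B R) :
    ∀ x, R ≤ x → f x ≤ B x := by
  intro x hx
  exact image_le_of_deriv_right_lt_deriv_boundary' (a := R) (b := x)
    (fun y hy => (hf y hy.1).continuousAt.continuousWithinAt)
    (fun y hy => (hf y hy.1).hasDerivWithinAt) hR
    (fun y hy => (hB y hy.1).continuousAt.continuousWithinAt)
    (fun y hy => (hB y hy.1).hasDerivWithinAt) (fun y hy => h y hy.1) (right_mem_Icc.2 hx)

/-- A function whose derivative is `O(r ^ (-γ - 1))` with `γ > 0` converges at infinity. -/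
theorem exists_tendsto_of_abs_deriv_le {f f' : ℝ → ℝ} {C γ R : ℝ} (hγ : 0 < γ) (hR : 0 < R)
    (hf : ∀ x, R ≤ x → HasDerivAt f (f' x) x)
    (hb : ∀ x, R ≤ x → |f' x| ≤ C * x ^ (-γ - 1)) : ∃ l, Tendsto f atTop (𝓝 l) := by
  set g : ℝ → ℝ := fun x => C / γ * x ^ (-γ) with hg
  have hgd : ∀ x, R ≤ x → HasDerivAt g (-(C * x ^ (-γ - 1))) x := fun x hx => by
    refine ((Real.hasDerivAt_rpow_const (p := -γ) (Or.inl (hR.trans_le hx).ne')).const_mul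
      (C / γ)).congr_deriv ?_
    field_simp
  have hg0 : Tendsto g atTop (𝓝 0) := by
    simpa using (tendsto_rpow_neg_atTop hγ).const_mul (C / γ)
  have hmono := monotoneOn_Ici_of_hasDerivAt (fun x hx => (hf x hx).fun_sub (hgd x hx))
    (fun x hx => by linarith [(abs_le.1 (hb x hx)).1])
  have hanti := antitoneOn_Ici_of_hasDerivAt (fun x hx => (hf x hx).fun_add (hgd x hx))
    (fun x hx => by linarith [(abs_le.1 (hb x hx)).2])
  have hC : 0 ≤ C := by
    have := (abs_nonneg _).trans (hb R le_rfl)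
    exact nonneg_of_mul_nonneg_left this (Real.rpow_pos_of_pos hR _)
  have hlim : ∃ l, Tendsto (fun x => f (max x R) + g (max x R)) atTop (𝓝 l) := by
    have ha : Antitone fun x => f (max x R) + g (max x R) := fun x y hxy =>
      hanti (le_max_right x R) (le_max_right y R) (max_le_max_right R hxy)
    refine ⟨_, tendsto_atTop_ciInf ha ⟨f R - g R, ?_⟩⟩
    rintro _ ⟨x, rfl⟩
    have h1 := hmono (le_refl R) (le_max_right x R) (le_max_right x R)
    have h2 : 0 ≤ g (max x R) :=
      mul_nonneg (div_nonneg hC hγ.le) (Real.rpow_nonneg (hR.le.trans (le_max_right _ _)) _)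
    simp only at h1 ⊢
    linarith
  obtain ⟨l, hl⟩ := hlim
  refine ⟨l, ?_⟩
  have h3 : Tendsto (fun x => f x + g x) atTop (𝓝 l) := hl.congr' <| by
    filter_upwards [eventually_ge_atTop R] with x hx
    rw [max_eq_left hx]
  simpa using h3.sub hg0

theorem eventually_lt_mul_rpow {k η : ℝ} (C : ℝ) (hk : 0 < k) (hη : 0 < η) :
    ∀ᶠ r : ℝ in atTop, C < k * r ^ η :=
  ((tendsto_rpow_atTop hη).const_mul_atTop hk).eventually_gt_atTop C

/-- The system satisfied by `w` and `θ = |w'| ^ (p - 1) / (r w)` along a positive decreasing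
solution of (E), where `u = -r w' / w` and `μ = 1 / (p - 1)`. -/
structure IsLogSystem (n q α a μ : ℝ) (w θ u : ℝ → ℝ) : Prop where
  w_pos : ∀ r, 0 < r → 0 < w r
  w_le : ∀ r, 0 < r → w r ≤ a
  θ_pos : ∀ r, 0 < r → 0 < θ r
  θ_lt : ∀ r, 0 < r → θ r < 1
  u_eq : ∀ r, 0 < r → u r = r ^ (1 + μ) * w r ^ (μ - 1) * θ r ^ μ
  derivW : ∀ r, 0 < r → HasDerivAt w (-(u r * w r / r)) r
  deriv_θ : ∀ r, 0 < r →
    HasDerivAt θ ((α + w r ^ (q - 1) - n * θ r - u r * (1 - θ r)) / r) r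

namespace IsLogSystem

variable {n q α a μ : ℝ} {w θ u : ℝ → ℝ}

theorem u_pos (h : IsLogSystem n q α a μ w θ u) {r : ℝ} (hr : 0 < r) : 0 < u r := by
  rw [h.u_eq r hr]
  have := h.w_pos r hr
  have := h.θ_pos r hr
  positivity

theorem w_anti (h : IsLogSystem n q α a μ w θ u) {r s : ℝ} (hr : 0 < r) (hrs : r ≤ s) :
    w s ≤ w r := by
  refine antitoneOn_Ici_of_hasDerivAt (fun x hx => h.derivW x (hr.trans_le hx))
    (fun x hx => ?_) (le_refl r) hrs hrs
  have hx0 := hr.trans_le hx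
  have := h.u_pos hx0
  have := h.w_pos x hx0
  exact neg_nonpos.2 (by positivity)

theorem rpow_w_le (h : IsLogSystem n q α a μ w θ u) (hq : 1 < q) {r : ℝ} (hr : 0 < r) :
    w r ^ (q - 1) ≤ a ^ (q - 1) :=
  Real.rpow_le_rpow (h.w_pos r hr).le (h.w_le r hr) (by linarith)

theorem hasDerivAt_J (h : IsLogSystem n q α a μ w θ u) (c : ℝ) {r : ℝ} (hr : 0 < r) :
    HasDerivAt (fun r => r ^ c * w r * (1 - θ r))
      (r ^ c * w r / r * (c - α - w r ^ (q - 1) + (n - c) * θ r)) r := by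
  have hD := ((Real.hasDerivAt_rpow_const (p := c) (Or.inl hr.ne')).fun_mul
    (h.derivW r hr)).fun_mul ((h.deriv_θ r hr).const_sub 1)
  refine hD.congr_deriv ?_
  rw [Real.rpow_sub_one hr.ne']
  field_simp
  ring

theorem J_pos (h : IsLogSystem n q α a μ w θ u) (c : ℝ) {r : ℝ} (hr : 0 < r) :
    0 < r ^ c * w r * (1 - θ r) :=
  mul_pos (mul_pos (Real.rpow_pos_of_pos hr _) (h.w_pos r hr)) (by linarith [h.θ_lt r hr])

theorem exists_le_w (h : IsLogSystem n q α a μ w θ u) (hq : 1 < q) {c : ℝ} (hα : 0 < α)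
    (hc : α < c) (hcn : c ≤ n) : ∃ k : ℝ, 0 < k ∧ ∀ᶠ r in atTop, k * r ^ (-c) ≤ w r := by
  by_cases hex : ∃ R, 0 < R ∧ w R ^ (q - 1) ≤ c - α
  · obtain ⟨R, hR, hwR⟩ := hex
    refine ⟨_, h.J_pos c hR, ?_⟩
    have hmono := monotoneOn_Ici_of_hasDerivAt
      (fun x (hx : R ≤ x) => h.hasDerivAt_J c (hR.trans_le hx)) (fun x hx => by
        have hx0 := hR.trans_le hx
        have h1 := h.w_pos x hx0
        have h2 : w x ^ (q - 1) ≤ c - α :=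
          (Real.rpow_le_rpow h1.le (h.w_anti hR hx) (by linarith)).trans hwR
        have h3 : 0 ≤ (n - c) * θ x := mul_nonneg (by linarith) (h.θ_pos x hx0).le
        exact mul_nonneg (by positivity) (by linarith))
    filter_upwards [eventually_ge_atTop R] with r hr
    have hr0 := hR.trans_le hr
    have h1 := h.w_pos r hr0
    have h2 := hmono (le_refl R) hr hr
    have h3 : r ^ c * w r * (1 - θ r) ≤ r ^ c * w r :=
      mul_le_of_le_one_right (by positivity) (by linarith [h.θ_pos r hr0])
    have h4 : 0 < r ^ c := by positivity
    rw [Real.rpow_neg hr0.le, ← div_eq_mul_inv, div_le_iff₀ h4]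
    simp only at h2
    linarith
  · push Not at hex
    have hc0 : 0 < c - α := by linarith
    refine ⟨(c - α) ^ (1 / (q - 1)), by positivity, ?_⟩
    filter_upwards [eventually_ge_atTop 1] with r hr
    have hr0 : 0 < r := by linarith
    have h1 : (c - α) ^ (1 / (q - 1)) ≤ w r := by
      have := Real.rpow_le_rpow hc0.le (hex r hr0).le
        (show 0 ≤ 1 / (q - 1) from one_div_nonneg.2 (by linarith))
      rwa [← Real.rpow_mul (h.w_pos r hr0).le, mul_one_div_cancel (by linarith),
        Real.rpow_one] at this
    exact (mul_le_of_le_one_right (by positivity)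
      (Real.rpow_le_one_of_one_le_of_nonpos hr (by linarith))).trans h1

theorem exists_le_u (h : IsLogSystem n q α a μ w θ u) (hq : 1 < q) (hα : 0 < α) (hn : α < n)
    (hμ : 0 < μ) (ha : 0 < a) (hL : μ < 1 ∨ 1 < μ ∧ α * (μ - 1) < 1 + μ) :
    ∃ k η : ℝ, 0 < k ∧ 0 < η ∧ ∀ᶠ r in atTop, k * r ^ η * θ r ^ μ ≤ u r := by
  rcases hL with hμ1 | ⟨hμ1, hαμ⟩
  · refine ⟨a ^ (μ - 1), 1 + μ, by positivity, by linarith, ?_⟩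
    filter_upwards [eventually_gt_atTop 0] with r hr
    have h1 : a ^ (μ - 1) ≤ w r ^ (μ - 1) :=
      Real.rpow_le_rpow_of_nonpos (h.w_pos r hr) (h.w_le r hr) (by linarith)
    have := h.θ_pos r hr
    rw [h.u_eq r hr, mul_comm (r ^ (1 + μ))]
    gcongr
  · have hμ0 : 0 < μ - 1 := by linarith
    obtain ⟨c, hαc, hc⟩ := exists_between (lt_min hn ((lt_div_iff₀ hμ0).2 hαμ))
    obtain ⟨hcn, hcμ⟩ := lt_min_iff.1 hc
    rw [lt_div_iff₀ hμ0] at hcμ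
    obtain ⟨k, hk, hkw⟩ := h.exists_le_w hq hα hαc hcn.le
    refine ⟨k ^ (μ - 1), 1 + μ - c * (μ - 1), by positivity, by linarith, ?_⟩
    filter_upwards [hkw, eventually_gt_atTop 0] with r hkr hr
    have h1 : (k * r ^ (-c)) ^ (μ - 1) ≤ w r ^ (μ - 1) :=
      Real.rpow_le_rpow (by positivity) hkr hμ0.le
    rw [Real.mul_rpow hk.le (by positivity), ← Real.rpow_mul hr.le] at h1
    have := h.θ_pos r hr
    rw [h.u_eq r hr, show 1 + μ - c * (μ - 1) = -c * (μ - 1) + (1 + μ) by ring,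
      Real.rpow_add hr _ (1 + μ), mul_comm (r ^ (1 + μ)), ← mul_assoc]
    gcongr

theorem exists_θ_le_half (h : IsLogSystem n q α a μ w θ u) (hq : 1 < q)
    (haN : a ^ (q - 1) ≤ n - α) (hμ : 0 < μ) {k η : ℝ} (hk : 0 < k) (hη : 0 < η)
    (hu : ∀ᶠ r in atTop, k * r ^ η * θ r ^ μ ≤ u r) :
    ∀ᶠ R in atTop, ∃ r, R ≤ r ∧ θ r ≤ 1 / 2 := by
  have hbig := eventually_lt_mul_rpow (n + 1) (mul_pos hk (Real.rpow_pos_of_pos one_half_pos μ)) hη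
  filter_upwards [eventually_forall_ge_atTop.2 (hu.and hbig), eventually_gt_atTop 0] with R hR hR0
  by_contra! hcon
  have hmono : MonotoneOn (fun r => (1 - θ r) / r) (Ici R) := by
    refine monotoneOn_Ici_of_hasDerivAt (fun x hx => ((h.deriv_θ x (hR0.trans_le hx)).const_sub
      1).fun_div (hasDerivAt_id' x) (hR0.trans_le hx).ne') fun x hx => ?_
    have hx0 := hR0.trans_le hx
    have h1 := h.rpow_w_le hq hx0
    obtain ⟨h2, h3⟩ := hR x hx
    have h4 : ((1 : ℝ) / 2) ^ μ ≤ θ x ^ μ :=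
      Real.rpow_le_rpow (by norm_num) (hcon x hx).le hμ.le
    have h5 : n + 1 ≤ u x := by
      refine h3.le.trans (le_trans ?_ h2)
      rw [mul_right_comm]
      gcongr
    refine div_nonneg ?_ (by positivity)
    have h6 : -((α + w x ^ (q - 1) - n * θ x - u x * (1 - θ x)) / x) * x =
      -(α + w x ^ (q - 1) - n * θ x - u x * (1 - θ x)) := by field_simp
    rw [h6]
    nlinarith [mul_nonneg (sub_nonneg.2 h5) (sub_nonneg.2 (h.θ_lt x hx0).le)]
  have hφ : 0 < (1 - θ R) / R := div_pos (by linarith [h.θ_lt R hR0]) hR0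
  have hev := eventually_lt_mul_rpow 1 hφ one_pos
  obtain ⟨r, hr, hrR⟩ := (hev.and (eventually_ge_atTop R)).exists
  have hr0 := hR0.trans_le hrR
  have h1 := hmono (le_refl R) hrR hrR
  simp only at h1
  rw [Real.rpow_one] at hr
  have h2 := hr.trans_le (mul_le_mul_of_nonneg_right h1 hr0.le)
  rw [div_mul_cancel₀ _ hr0.ne'] at h2
  linarith [h.θ_pos r hr0]

theorem eventually_θ_le_half (h : IsLogSystem n q α a μ w θ u) (hq : 1 < q) (hα : 0 < α)
    (hn : α < n) (haN : a ^ (q - 1) ≤ n - α) (hμ : 0 < μ) {k η : ℝ} (hk : 0 < k) (hη : 0 < η)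
    (hu : ∀ᶠ r in atTop, k * r ^ η * θ r ^ μ ≤ u r) : ∀ᶠ r in atTop, θ r ≤ 1 / 2 := by
  have hbig := eventually_lt_mul_rpow (2 * n) (mul_pos hk (Real.rpow_pos_of_pos one_half_pos μ)) hη
  obtain ⟨R, ⟨⟨hR, hR0⟩, R', hRR', hR'⟩⟩ := (((eventually_forall_ge_atTop.2 (hu.and hbig)).and
    (eventually_gt_atTop 0)).and (h.exists_θ_le_half hq haN hμ hk hη hu)).exists
  filter_upwards [eventually_ge_atTop R'] with r hr
  refine le_barrier_of_deriv_lt (fun x hx => h.deriv_θ x (hR0.trans_le (hRR'.trans hx)))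
    (fun x _ => hasDerivAt_const x (1 / 2 : ℝ)) (fun x hx hθ => ?_) hR' r hr
  have hx0 := hR0.trans_le (hRR'.trans hx)
  obtain ⟨h2, h3⟩ := hR x (hRR'.trans hx)
  have h1 := h.rpow_w_le hq hx0
  rw [hθ, mul_right_comm] at h2
  refine div_neg_of_neg_of_pos ?_ hx0
  rw [hθ]
  linarith

theorem exists_θ_decay (h : IsLogSystem n q α a μ w θ u) (hq : 1 < q) (hα : 0 < α)
    (hn : α < n) (haN : a ^ (q - 1) ≤ n - α) (hμ : 0 < μ) {k η : ℝ} (hk : 0 < k) (hη : 0 < η)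
    (hu : ∀ᶠ r in atTop, k * r ^ η * θ r ^ μ ≤ u r) :
    ∃ β : ℝ, 0 < β ∧ ∀ᶠ r in atTop, θ r ≤ r ^ (-β) := by
  set β := η / 2 / μ with hβ
  have hβ0 : 0 < β := by positivity
  refine ⟨β, hβ0, ?_⟩
  have hbig := eventually_lt_mul_rpow (n + β + 1) (half_pos hk) (half_pos hη)
  obtain ⟨R, hR, hR1⟩ := ((eventually_forall_ge_atTop.2 ((hu.and hbig).and
    (h.eventually_θ_le_half hq hα hn haN hμ hk hη hu))).and
    (eventually_ge_atTop 1)).exists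
  have hR0 : 0 < R := by linarith
  have hneg : ∀ x, R ≤ x → x ^ (-β) ≤ θ x →
      α + w x ^ (q - 1) - n * θ x - u x * (1 - θ x) < -β - 1 := fun x hx hθ => by
    have hx0 := hR0.trans_le hx
    obtain ⟨⟨h2, h3⟩, h4⟩ := hR x hx
    have h1 := h.rpow_w_le hq hx0
    have h5 : (x ^ (-β)) ^ μ ≤ θ x ^ μ := Real.rpow_le_rpow (by positivity) hθ hμ.le
    have h6 : k * x ^ (η / 2) ≤ u x := by
      refine le_trans ?_ h2
      calc k * x ^ (η / 2) = k * x ^ η * (x ^ (-β)) ^ μ := by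
            rw [← Real.rpow_mul hx0.le, mul_assoc, ← Real.rpow_add hx0]
            congr 2
            rw [hβ]
            field_simp
            ring
        _ ≤ k * x ^ η * θ x ^ μ := by gcongr
    have h7 := h.u_pos hx0
    have h8 : 0 < n * θ x := mul_pos (by linarith) (h.θ_pos x hx0)
    nlinarith
  obtain ⟨R', hRR', hR'⟩ : ∃ r, R ≤ r ∧ θ r ≤ r ^ (-β) := by
    by_contra! hcon
    have hanti := antitoneOn_Ici_of_hasDerivAt (fun x (hx : R ≤ x) =>
      (h.deriv_θ x (hR0.trans_le hx)).fun_add (Real.hasDerivAt_log (hR0.trans_le hx).ne'))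
      (fun x hx => by
        have hx0 := hR0.trans_le hx
        rw [← one_div, ← add_div]
        exact div_nonpos_of_nonpos_of_nonneg (by linarith [hneg x hx (hcon x hx).le]) hx0.le)
    obtain ⟨r, hr, hrR⟩ := ((Real.tendsto_log_atTop.eventually_gt_atTop
      (θ R + Real.log R)).and (eventually_ge_atTop R)).exists
    have := hanti (le_refl R) hrR hrR
    simp only at this
    linarith [h.θ_pos r (hR0.trans_le hrR)]
  filter_upwards [eventually_ge_atTop R'] with r hr
  refine le_barrier_of_deriv_lt (fun x hx => h.deriv_θ x (hR0.trans_le (hRR'.trans hx)))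
    (fun x hx => Real.hasDerivAt_rpow_const (Or.inl (hR0.trans_le (hRR'.trans hx)).ne'))
    (fun x hx hθ => ?_) hR' r hr
  have hx1 := hR1.trans (hRR'.trans hx)
  have hx0 : 0 < x := by linarith
  rw [Real.rpow_sub_one hx0.ne', mul_div_assoc', div_lt_div_iff_of_pos_right hx0]
  have h1 : x ^ (-β) ≤ 1 := Real.rpow_le_one_of_one_le_of_nonpos hx1 (by linarith)
  nlinarith [hneg x (hRR'.trans hx) hθ.ge]

theorem exists_w_decay (h : IsLogSystem n q α a μ w θ u) (hα : 0 < α) (hn : α < n) {β : ℝ}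
    (hβ : 0 < β) (hθ : ∀ᶠ r in atTop, θ r ≤ r ^ (-β)) (hθ2 : ∀ᶠ r in atTop, θ r ≤ 1 / 2) :
    ∃ C : ℝ, 0 < C ∧ ∀ᶠ r in atTop, w r ≤ C * r ^ (-(α / 2)) := by
  have hn0 : 0 < n := by linarith
  have hsmall : ∀ᶠ r : ℝ in atTop, r ^ (-β) < α / 2 / n :=
    (tendsto_rpow_neg_atTop hβ).eventually_lt_const (by positivity)
  obtain ⟨R, hR, hR0⟩ := ((eventually_forall_ge_atTop.2 ((hθ.and hsmall).and hθ2)).and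
    (eventually_gt_atTop 0)).exists
  have hanti := antitoneOn_Ici_of_hasDerivAt
    (fun x (hx : R ≤ x) => h.hasDerivAt_J (α / 2) (hR0.trans_le hx)) (fun x hx => by
      have hx0 := hR0.trans_le hx
      have h1 := h.w_pos x hx0
      obtain ⟨⟨h2, h3⟩, -⟩ := hR x hx
      have h4 := h.θ_pos x hx0
      have h5 := (lt_div_iff₀ hn0).1 (h2.trans_lt h3)
      have h6 : 0 < w x ^ (q - 1) := by positivity
      have h7 : 0 < α * θ x := by positivity
      exact mul_nonpos_of_nonneg_of_nonpos (by positivity) (by linarith))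
  refine ⟨_, mul_pos two_pos (h.J_pos (α / 2) hR0), ?_⟩
  filter_upwards [eventually_ge_atTop R] with r hr
  have hr0 := hR0.trans_le hr
  have h1 := hanti (le_refl R) hr hr
  simp only at h1
  have h2 : 0 < r ^ (α / 2) := by positivity
  have h3 := mul_pos h2 (h.w_pos r hr0)
  rw [Real.rpow_neg hr0.le, ← div_eq_mul_inv, le_div_iff₀ h2]
  nlinarith [(hR r hr).2]

/-- The limit of `r ^ α * w r` exists and is positive. -/
theorem exists_tendsto (h : IsLogSystem n q α a μ w θ u) (hq : 1 < q) (hα : 0 < α)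
    (hn : α < n) (ha : 0 < a) (haN : a ^ (q - 1) ≤ n - α) (hμ : 0 < μ)
    (hL : μ < 1 ∨ 1 < μ ∧ α * (μ - 1) < 1 + μ) :
    ∃ L, 0 < L ∧ Tendsto (fun r => r ^ α * w r) atTop (𝓝 L) := by
  obtain ⟨k, η, hk, hη, hu⟩ := h.exists_le_u hq hα hn hμ ha hL
  have hθ2 := h.eventually_θ_le_half hq hα hn haN hμ hk hη hu
  obtain ⟨β, hβ, hθ⟩ := h.exists_θ_decay hq hα hn haN hμ hk hη hu
  obtain ⟨C, hC, hw⟩ := h.exists_w_decay hα hn hβ hθ hθ2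
  have hq0 : 0 < q - 1 := by linarith
  set γ := min β (α / 2 * (q - 1)) with hγ
  have hγ0 : 0 < γ := lt_min hβ (by positivity)
  obtain ⟨R, hR, hR1⟩ := ((eventually_forall_ge_atTop.2 ((hθ.and hw).and hθ2)).and
    (eventually_ge_atTop 1)).exists
  have hR0 : 0 < R := by linarith
  obtain ⟨l, hl⟩ := exists_tendsto_of_abs_deriv_le (C := 2 * (n + C ^ (q - 1))) hγ0 hR0
    (fun x (hx : R ≤ x) => (h.hasDerivAt_J α (hR0.trans_le hx)).log
      (h.J_pos α (hR0.trans_le hx)).ne') (fun x hx => by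
      have hx1 := hR1.trans hx
      have hx0 := hR0.trans_le hx
      obtain ⟨⟨h1, h2⟩, h3⟩ := hR x hx
      have hw0 := h.w_pos x hx0
      have hθ0 := h.θ_pos x hx0
      have h4 : θ x ≤ x ^ (-γ) :=
        h1.trans (Real.rpow_le_rpow_of_exponent_le hx1 (neg_le_neg (min_le_left _ _)))
      have h5 : w x ^ (q - 1) ≤ C ^ (q - 1) * x ^ (-γ) := by
        refine (Real.rpow_le_rpow hw0.le h2 hq0.le).trans ?_
        rw [Real.mul_rpow hC.le (by positivity), ← Real.rpow_mul hx0.le]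
        gcongr
        rw [neg_mul]
        exact neg_le_neg (min_le_right _ _)
      have h6 : 0 < 1 - θ x := by linarith
      have e : x ^ α * w x / x * (α - α - w x ^ (q - 1) + (n - α) * θ x) /
          (x ^ α * w x * (1 - θ x)) = ((n - α) * θ x - w x ^ (q - 1)) / (1 - θ x) / x := by
        have : 0 < x ^ α := by positivity
        field_simp
        ring
      rw [e, Real.rpow_sub_one hx0.ne', abs_div, abs_of_pos hx0, mul_div_assoc',
        div_le_div_iff_of_pos_right hx0, abs_div, abs_of_pos h6, div_le_iff₀ h6]
      have h7 : 0 < w x ^ (q - 1) := by positivity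
      have h8 : |(n - α) * θ x - w x ^ (q - 1)| ≤ (n + C ^ (q - 1)) * x ^ (-γ) := by
        have h9 : (n - α) * θ x ≤ n * x ^ (-γ) := by
          gcongr <;> linarith
        have h10 : 0 < (n - α) * θ x := mul_pos (by linarith) hθ0
        rw [abs_le]
        constructor <;> linarith
      have h11 : 0 ≤ (n + C ^ (q - 1)) * x ^ (-γ) := (abs_nonneg _).trans h8
      nlinarith)
  refine ⟨Real.exp l, Real.exp_pos l, ?_⟩
  have hθlim : Tendsto θ atTop (𝓝 0) :=
    tendsto_of_tendsto_of_tendsto_of_le_of_le' tendsto_const_nhds (tendsto_rpow_neg_atTop hβ)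
      ((eventually_gt_atTop 0).mono fun r hr => (h.θ_pos r hr).le) hθ
  have hJ := ((Real.continuous_exp.tendsto l).comp hl).div (hθlim.const_sub 1) (by norm_num)
  rw [sub_zero, div_one] at hJ
  refine hJ.congr' ?_
  filter_upwards [eventually_gt_atTop 0] with r hr
  have h6 : 0 < 1 - θ r := by linarith [h.θ_lt r hr]
  simp only [Function.comp, Pi.div_apply]
  rw [Real.exp_log (h.J_pos α hr)]
  field_simp

end IsLogSystem

theorem phiP_of_neg {p x : ℝ} (hx : x < 0) : phiP p x = -(-x) ^ (p - 1) := by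
  have hx' : 0 < -x := by linarith
  rw [phiP, abs_of_neg hx, show p - 1 = p - 2 + 1 by ring, Real.rpow_add_one hx'.ne']
  ring

theorem IsProfile.isLogSystem {m : ℕ} {p q α a : ℝ} {w d : ℝ → ℝ}
    (h : IsProfile (m + 1 : ℝ) p q α a w d) (hp : 1 < p) (hα : 0 < α) (hq : 1 < q) (ha : 0 < a)
    (haN : a ^ (q - 1) ≤ m + 1 - α) :
    IsLogSystem (m + 1) q α a (1 / (p - 1)) w (fun r => -phiP p (d r) / (r * w r))
      (fun r => -(r * d r) / w r) := by
  have hn : (1 : ℝ) ≤ m + 1 := by linarith [(Nat.cast_nonneg m : (0 : ℝ) ≤ m)]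
  have hpos := h.pos hα hq ha haN
  have hd : ∀ r, 0 < r → d r < 0 := fun r hr =>
    h.d_neg hn hα (R := r + 1) (fun s hs => hpos s hs.1) ⟨hr, by linarith⟩
  have hP : ∀ r, 0 < r → phiP p (d r) < 0 := fun r hr =>
    h.phiP_neg hn hα (R := r + 1) (fun s hs => hpos s hs.1) r ⟨hr, by linarith⟩
  have hrw : ∀ r, 0 < r → 0 < r * w r := fun r hr => mul_pos hr (hpos r hr.le)
  refine ⟨fun r hr => hpos r hr.le, fun r hr => ?_, fun r hr => ?_, fun r hr => ?_,
    fun r hr => ?_, fun r hr => ?_, fun r hr => ?_⟩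
  · exact (h.lt_initial hn hα (R := r + 1) (fun s hs => hpos s hs.1) ⟨hr, by linarith⟩).le
  · exact div_pos (neg_pos.2 (hP r hr)) (hrw r hr)
  · rw [div_lt_one (hrw r hr)]
    linarith [h.phiP_add_mul_pos hα hq haN hr fun s hs => hpos s hs.1]
  · have hw0 := hpos r hr.le
    have hd0 : 0 < -d r := neg_pos.2 (hd r hr)
    have hp0 : p - 1 ≠ 0 := by linarith
    rw [phiP_of_neg (hd r hr), neg_neg, Real.div_rpow (by positivity) (hrw r hr).le,
      ← Real.rpow_mul hd0.le, mul_one_div_cancel hp0, Real.rpow_one, Real.mul_rpow hr.le hw0.le,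
      Real.rpow_one_add' hr.le (by positivity), Real.rpow_sub_one hw0.ne']
    have h1 : 0 < r ^ (1 / (p - 1)) := by positivity
    have h2 : 0 < w r ^ (1 / (p - 1)) := by positivity
    field_simp
  · refine (h.derivW r hr).congr_deriv ?_
    have hw0 := hpos r hr.le
    field_simp
  · have hw0 := hpos r hr.le
    refine ((h.derivP r hr).fun_neg.fun_div ((hasDerivAt_id' r).fun_mul (h.derivW r hr))
      (hrw r hr).ne').congr_deriv ?_
    rw [abs_of_pos hw0]
    field_simp
    ring

/-- Assume (L) and `α < N`, and set `a̲ = (N-α)^{1/(q-1)}`. For any `a ∈ (0, a̲]`,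
the global solution `w(·,a)` is positive on `[0,∞)` and `L(a) > 0`. -/
theorem stmt14 (N : ℕ) (hN : 1 ≤ N) (p q α : ℝ) (hp : 1 < p) (hq : 1 < q) (hα : 0 < α)
    (hL : 2 < p ∨ (p < 2 ∧ α < p / (2 - p))) (hαN : α < N)
    (a : ℝ) (ha : 0 < a) (ha' : a ≤ ((N : ℝ) - α) ^ (1 / (q - 1)))
    (w : ℝ → ℝ) (hw : IsGlobalSolution N p q α a w) :
    (∀ r ∈ Ici (0 : ℝ), 0 < w r) ∧
    ∃ L : ℝ, 0 < L ∧ Tendsto (fun r => r ^ α * w r) atTop (𝓝 L) := by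
  obtain ⟨m, rfl⟩ : ∃ m, N = m + 1 := ⟨N - 1, by omega⟩
  have hprof := hw.isProfile
  push_cast at hprof hαN ha'
  have hq0 : 0 < q - 1 := by linarith
  have haN : a ^ (q - 1) ≤ m + 1 - α := by
    have h1 : (0 : ℝ) ≤ m + 1 - α := by linarith
    have := Real.rpow_le_rpow ha.le ha' hq0.le
    rwa [← Real.rpow_mul h1, one_div_mul_cancel hq0.ne', Real.rpow_one] at this
  refine ⟨hprof.pos hα hq ha haN, ?_⟩
  have hp0 : 0 < p - 1 := by linarith
  refine (hprof.isLogSystem hp hα hq ha haN).exists_tendsto hq hα hαN ha haN (by positivity) ?_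
  rcases hL with hp2 | ⟨hp2, hδ⟩
  · exact Or.inl ((div_lt_one hp0).2 (by linarith))
  · refine Or.inr ⟨(one_lt_div hp0).2 (by linarith), ?_⟩
    rw [lt_div_iff₀ (by linarith)] at hδ
    have e1 : α * (1 / (p - 1) - 1) = α * (2 - p) / (p - 1) := by
      field_simp
      ring
    have e2 : 1 + 1 / (p - 1) = p / (p - 1) := by
      field_simp
      ring
    rw [e1, e2]
    gcongr
end

section
/- Assume condition (L): p > 2, or p < 2 and α < δ, together with one of the following: (i) p₂ < p, α ≤ N/2 and q ≥ q*; (ii) p ≤ p₂; (iii) p₂ < p, N/2 < α < (N-1)p'/2 where p' = p/(p-1), and q ≥ q*_α, where q*_α is defined by 1/(q*_α + 1) = (N-1)/(2α) - 1/p'. Then for every a > 0, the global solution w(·,a) satisfies w(r,a) > 0 for all r ∈ [0,∞) and L(a) = lim_{r→∞} r^α w(r,a) > 0. -/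
open Set Filter Topology Asymptotics

/-- The Pohozaev type energy
`r ^ l * (|w'| ^ p / p' + w ^ (q + 1) / (q + 1) + e * w ^ 2 / 2 - σ * w * ψ / r)`,
where `p' = p / (p - 1)` and `ψ = |w'| ^ (p - 1)`. -/
noncomputable def pohozaev (p q l σ e : ℝ) (w ψ : ℝ → ℝ) (r : ℝ) : ℝ :=
  r ^ l * (ψ r ^ (p / (p - 1)) / (p / (p - 1)) + w r ^ (q + 1) / (q + 1) + e * w r ^ 2 / 2)
    - σ * r ^ (l - 1) * (w r * ψ r)

theorem hasDerivAt_pohozaev {n p q α l σ e : ℝ} {w ψ : ℝ → ℝ} {r : ℝ} (hp : 1 < p) (hq : 1 < q)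
    (hr : 0 < r) (hw : 0 < w r) (hψ : 0 < ψ r)
    (dw : HasDerivAt w (-(ψ r) ^ (1 / (p - 1))) r)
    (dψ : HasDerivAt ψ
      (α * w r + w r ^ q - r * ψ r ^ (1 / (p - 1)) - (n - 1) / r * ψ r) r) :
    HasDerivAt (pohozaev p q l σ e w ψ)
      (-(r ^ (l - 1) * ((n - 1 - σ - l / (p / (p - 1))) * (ψ r * ψ r ^ (1 / (p - 1)))
        + (σ - l / (q + 1)) * w r ^ (q + 1) + σ * (l - n) * (w r * ψ r / r)
        + (r * ψ r ^ (1 / (p - 1))) ^ 2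
        - (α - e + σ) * (r * ψ r ^ (1 / (p - 1))) * w r
        + (σ * α - l * e / 2) * w r ^ 2))) r := by
  have hp0 : 0 < p - 1 := by linarith
  have hpp : 0 < p / (p - 1) := by positivity
  have d1 := dψ.rpow_const (p := p / (p - 1)) (Or.inl hψ.ne')
  have d2 := dw.rpow_const (p := q + 1) (Or.inl hw.ne')
  have d3 := dw.pow 2
  have dr := (hasDerivAt_id r).rpow_const (p := l) (Or.inl hr.ne')
  have dr1 := (hasDerivAt_id r).rpow_const (p := l - 1) (Or.inl hr.ne')
  have := (dr.mul (((d1.div_const (p / (p - 1))).add (d2.div_const (q + 1))).add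
    ((d3.const_mul e).div_const 2))).sub ((dr1.const_mul σ).mul (dw.mul dψ))
  refine this.congr_deriv ?_
  have e1 : p / (p - 1) - 1 = 1 / (p - 1) := by field_simp; ring
  have e2 : ψ r ^ (p / (p - 1)) = ψ r * ψ r ^ (1 / (p - 1)) := by
    rw [← e1, Real.rpow_sub_one hψ.ne']; field_simp
  have e3 : w r ^ (q + 1) = w r * w r ^ q := by rw [Real.rpow_add_one hw.ne']; ring
  have e4 : r ^ l = r * r ^ (l - 1) := by rw [Real.rpow_sub_one hr.ne']; field_simp
  have e5 : r ^ (l - 1 - 1) = r ^ (l - 1) / r := Real.rpow_sub_one hr.ne' _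
  have e6 : q + 1 - 1 = q := by ring
  simp only [id, Pi.add_apply, Pi.mul_apply, Pi.pow_apply, e1, e2, e3, e4, e5, e6]
  generalize ψ r ^ (1 / (p - 1)) = m
  generalize r ^ (l - 1) = ρ
  generalize w r ^ q = z
  have : q + 1 ≠ 0 := by linarith
  field_simp
  ring

theorem continuousOn_pohozaev {p q l σ e : ℝ} {w ψ : ℝ → ℝ} (hp : 1 < p) (hq : 1 < q) (hl : 1 ≤ l)
    (cw : ContinuousOn w (Ici 0)) (cψ : ContinuousOn ψ (Ici 0)) :
    ContinuousOn (pohozaev p q l σ e w ψ) (Ici 0) := by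
  have hpp : 0 ≤ p / (p - 1) := div_nonneg (by linarith) (by linarith)
  refine ContinuousOn.sub (ContinuousOn.mul ?_ (ContinuousOn.add (ContinuousOn.add ?_ ?_) ?_))
    (ContinuousOn.mul ?_ (cw.mul cψ))
  · exact (Real.continuous_rpow_const (by linarith)).continuousOn
  · exact (cψ.rpow_const fun _ _ => Or.inr hpp).div_const _
  · exact (cw.rpow_const fun _ _ => Or.inr (by linarith)).div_const _
  · exact (continuousOn_const.mul (cw.pow 2)).div_const _
  · exact continuousOn_const.mul (Real.continuous_rpow_const (by linarith)).continuousOn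

theorem pohozaev_neg {n p q α l σ a R : ℝ} {w ψ : ℝ → ℝ} (hp : 1 < p) (hq : 1 < q)
    (ha : 0 < a) (hn : 1 ≤ n) (hnl : n ≤ l) (hσ : 0 < σ)
    (h1 : l / (p / (p - 1)) ≤ n - 1 - σ) (h2 : l / (q + 1) ≤ σ)
    (h3 : 0 ≤ (2 * σ - l) * (2 * α - l))
    (cw : ContinuousOn w (Ici 0)) (w0 : w 0 = a) (cψ : ContinuousOn ψ (Ici 0)) (ψ0 : ψ 0 = 0)
    (hw : ∀ r ∈ Ico 0 R, 0 < w r)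
    (hf : ∀ r ∈ Ioo 0 R, 0 < ψ r ∧ HasDerivAt w (-(ψ r) ^ (1 / (p - 1))) r ∧
      HasDerivAt ψ (α * w r + w r ^ q - r * ψ r ^ (1 / (p - 1)) - (n - 1) / r * ψ r) r) :
    AntitoneOn (pohozaev p q l σ (α + σ - l) w ψ) (Icc 0 R) ∧
      ∀ r ∈ Ioc 0 R, pohozaev p q l σ (α + σ - l) w ψ r < 0 := by
  have hl : 1 ≤ l := hn.trans hnl
  have hp0 : 0 < p - 1 := by linarith
  set V := pohozaev p q l σ (α + σ - l) w ψ with hV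
  have cV : ContinuousOn V (Ici 0) := continuousOn_pohozaev hp hq hl cw cψ
  have key : ∀ r ∈ Ioo 0 R, ∃ V', HasDerivAt V V' r ∧
      V' ≤ -(r ^ (l - 1) * (r * ψ r ^ (1 / (p - 1)) - l / 2 * w r) ^ 2) := by
    intro r hr
    obtain ⟨hψ, dw, dψ⟩ := hf r hr
    have hwr := hw r ⟨hr.1.le, hr.2⟩
    have hr0 := hr.1
    refine ⟨_, hasDerivAt_pohozaev hp hq hr.1 hwr hψ dw dψ, neg_le_neg ?_⟩
    refine mul_le_mul_of_nonneg_left ?_ (Real.rpow_nonneg hr.1.le _)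
    have m0 : 0 < ψ r ^ (1 / (p - 1)) := Real.rpow_pos_of_pos hψ _
    have z0 : 0 < w r ^ (q + 1) := Real.rpow_pos_of_pos hwr _
    generalize ψ r ^ (1 / (p - 1)) = m at *
    have t1 : 0 ≤ (n - 1 - σ - l / (p / (p - 1))) * (ψ r * m) :=
      mul_nonneg (by linarith) (by positivity)
    have t2 : 0 ≤ (σ - l / (q + 1)) * w r ^ (q + 1) := mul_nonneg (by linarith) z0.le
    have t3 : 0 ≤ σ * (l - n) * (w r * ψ r / r) :=
      mul_nonneg (mul_nonneg hσ.le (by linarith)) (by positivity)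
    have t4 : 0 ≤ (2 * σ - l) * (2 * α - l) * w r ^ 2 := mul_nonneg h3 (sq_nonneg _)
    nlinarith
  have hle : AntitoneOn V (Icc 0 R) := by
    refine antitoneOn_of_deriv_nonpos (convex_Icc _ _) (cV.mono Icc_subset_Ici_self) ?_ ?_
    · intro r hr
      rw [interior_Icc] at hr
      obtain ⟨V', h, -⟩ := key r hr
      exact h.differentiableAt.differentiableWithinAt
    · intro r hr
      rw [interior_Icc] at hr
      obtain ⟨V', h, h'⟩ := key r hr
      rw [h.deriv]
      refine h'.trans (neg_nonpos.2 (mul_nonneg (Real.rpow_nonneg hr.1.le _) (sq_nonneg _)))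
  refine ⟨hle, fun r hr => ?_⟩
  have V0 : V 0 = 0 := by
    simp [hV, pohozaev, ψ0, Real.zero_rpow (show l ≠ 0 by linarith)]
  obtain ⟨d, hd0, hd⟩ : ∃ d > 0, ∀ r ∈ Ioo 0 d, r * ψ r ^ (1 / (p - 1)) - l / 2 * w r < 0 := by
    have c : ContinuousOn (fun r => r * ψ r ^ (1 / (p - 1)) - l / 2 * w r) (Ici 0) :=
      (continuousOn_id.mul (cψ.rpow_const fun _ _ => Or.inr (by positivity))).sub
        (continuousOn_const.mul cw)
    have t := (c 0 self_mem_Ici).mono_left (nhdsWithin_mono _ Ioi_subset_Ici_self)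
    have := t.eventually_lt_const (u := 0) (by
      simp only [w0, zero_mul]; nlinarith [mul_pos (show 0 < l by linarith) ha])
    obtain ⟨d, hd, h⟩ := mem_nhdsGT_iff_exists_Ioo_subset.1 this
    exact ⟨d, hd, fun r hr => h hr⟩
  have hdr : 0 < min d r := lt_min hd0 hr.1
  have hs : StrictAntiOn V (Icc 0 (min d r)) := by
    refine strictAntiOn_of_deriv_neg (convex_Icc _ _) (cV.mono Icc_subset_Ici_self) ?_
    intro x hx
    rw [interior_Icc] at hx
    have hx2 := lt_min_iff.1 hx.2
    obtain ⟨V', h, h'⟩ := key x ⟨hx.1, hx2.2.trans_le hr.2⟩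
    rw [h.deriv]
    refine h'.trans_lt (neg_neg_of_pos (mul_pos (Real.rpow_pos_of_pos hx.1 _) ?_))
    exact sq_pos_of_neg (hd x ⟨hx.1, hx2.1⟩)
  calc V r ≤ V (min d r) := hle ⟨hdr.le, (min_le_right _ _).trans hr.2⟩ ⟨hr.1.le, hr.2⟩
        (min_le_right _ _)
    _ < V 0 := hs ⟨le_rfl, hdr.le⟩ ⟨hdr.le, le_rfl⟩ hdr
    _ = 0 := V0

theorem pos_of_pohozaev {n p q α l σ a : ℝ} {w ψ : ℝ → ℝ} (hp : 1 < p) (hq : 1 < q)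
    (ha : 0 < a) (hn : 1 ≤ n) (hnl : n ≤ l) (hσ : 0 < σ)
    (h1 : l / (p / (p - 1)) ≤ n - 1 - σ) (h2 : l / (q + 1) ≤ σ)
    (h3 : 0 ≤ (2 * σ - l) * (2 * α - l))
    (cw : ContinuousOn w (Ici 0)) (w0 : w 0 = a) (cψ : ContinuousOn ψ (Ici 0)) (ψ0 : ψ 0 = 0)
    (hf : ∀ R, (∀ r ∈ Ico 0 R, 0 < w r) → ∀ r ∈ Ioo 0 R, 0 < ψ r ∧
      HasDerivAt w (-(ψ r) ^ (1 / (p - 1))) r ∧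
      HasDerivAt ψ (α * w r + w r ^ q - r * ψ r ^ (1 / (p - 1)) - (n - 1) / r * ψ r) r) :
    ∀ r ∈ Ici (0 : ℝ), 0 < w r := by
  by_contra! hcon
  obtain ⟨r₁, hr₁, hw₁⟩ := hcon
  have ivt : ∀ x, 0 ≤ x → w x ≤ 0 → ∃ z ∈ Icc 0 x, w z = 0 := fun x hx hwx =>
    intermediate_value_Icc' hx (cw.mono Icc_subset_Ici_self) ⟨hwx, by rw [w0]; exact ha.le⟩
  have hcl : IsCompact (Icc 0 r₁ ∩ w ⁻¹' {0}) :=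
    isCompact_Icc.of_isClosed_subset
      ((cw.mono Icc_subset_Ici_self).preimage_isClosed_of_isClosed isClosed_Icc isClosed_singleton)
      inter_subset_left
  obtain ⟨z, hz, hwz⟩ := ivt r₁ hr₁ hw₁
  obtain ⟨R, ⟨hR, hwR⟩, hleast⟩ := hcl.exists_isLeast ⟨z, hz, hwz⟩
  have hwR : w R = 0 := hwR
  have hR0 : 0 < R := by
    refine lt_of_le_of_ne hR.1 ?_
    rintro rfl
    exact ha.ne' (w0 ▸ hwR)
  have hpos : ∀ r ∈ Ico 0 R, 0 < w r := by
    intro r hr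
    by_contra! hwr
    obtain ⟨y, hy, hwy⟩ := ivt r hr.1 hwr
    have : R ≤ y := hleast ⟨⟨hy.1, hy.2.trans (hr.2.le.trans hR.2)⟩, hwy⟩
    exact absurd hr.2 (not_lt.2 (this.trans hy.2))
  have hV := (pohozaev_neg hp hq ha hn hnl hσ h1 h2 h3 cw w0 cψ ψ0 hpos (hf R hpos)).2 R ⟨hR0, le_rfl⟩
  have hψR : 0 ≤ ψ R := by
    refine ge_of_tendsto (((cψ R hR.1).continuousAt (Ici_mem_nhds hR0)).tendsto.mono_left
      (nhdsWithin_le_nhds (s := Iio R))) ?_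
    filter_upwards [Ioo_mem_nhdsLT hR0] with r hr
    exact (hf R hpos r hr).1.le
  refine absurd hV (not_lt.2 ?_)
  have hpp : 0 < p / (p - 1) := div_pos (by linarith) (by linarith)
  rw [pohozaev, hwR, Real.zero_rpow (by linarith)]
  have := Real.rpow_nonneg hψR (p / (p - 1))
  have := Real.rpow_nonneg hR0.le l
  simp only [zero_div, zero_mul, add_zero, mul_zero, sub_zero, ne_eq, OfNat.ofNat_ne_zero,
    not_false_eq_true, zero_pow]
  positivity

theorem eq_neg_rpow_of_phiP_neg {p x : ℝ} (hp : 1 < p) (h : phiP p x < 0) :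
    x = -(-phiP p x) ^ (1 / (p - 1)) := by
  have hx : x < 0 := by
    by_contra! hx
    exact absurd h (not_lt.2 (mul_nonneg (Real.rpow_nonneg (abs_nonneg x) _) hx))
  have h0 : 0 < -x := by linarith
  have : -phiP p x = (-x) ^ (p - 1) := by
    have : p - 1 = p - 2 + 1 := by ring
    rw [this, Real.rpow_add_one h0.ne', phiP, abs_of_neg hx]; ring
  rw [this, ← Real.rpow_mul h0.le, mul_one_div_cancel (by linarith), Real.rpow_one, neg_neg]

theorem phiP_eq_zero {p x : ℝ} (h : phiP p x = 0) : x = 0 := by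
  by_contra hx
  exact mul_ne_zero (Real.rpow_pos_of_pos (abs_pos.2 hx) _).ne' hx h

theorem IsGlobalSolution.exists_flux {N : ℕ} (hN : 1 ≤ N) {p q α a : ℝ} (hp : 1 < p) (hq : 1 < q)
    (hα : 0 < α) (ha : 0 < a) {w : ℝ → ℝ} (hw : IsGlobalSolution N p q α a w) :
    ∃ ψ : ℝ → ℝ, ContinuousOn w (Ici 0) ∧ w 0 = a ∧ ContinuousOn ψ (Ici 0) ∧ ψ 0 = 0 ∧
      ∀ R, (∀ r ∈ Ico 0 R, 0 < w r) → ∀ r ∈ Ioo 0 R, 0 < ψ r ∧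
        HasDerivAt w (-(ψ r) ^ (1 / (p - 1))) r ∧
        HasDerivAt ψ
          (α * w r + w r ^ q - r * ψ r ^ (1 / (p - 1)) - ((N : ℝ) - 1) / r * ψ r) r := by
  obtain ⟨cw, cy, heq, w0, w0'⟩ := hw
  set v := derivWithin w (Ici 0) with hv
  set y := fun r => phiP p (v r) with hy
  have cv : ContinuousOn v (Ici 0) := cw.continuousOn_derivWithin (uniqueDiffOn_Ici 0) le_rfl
  have cy' : ContinuousOn (derivWithin y (Ici 0)) (Ici 0) :=
    cy.continuousOn_derivWithin (uniqueDiffOn_Ici 0) le_rfl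
  have dy : ∀ r ∈ Ici (0 : ℝ), HasDerivWithinAt y (derivWithin y (Ici 0) r) (Ici 0) r :=
    fun r hr => ((cy.differentiableOn one_ne_zero) r hr).hasDerivWithinAt
  have dw : ∀ r ∈ Ici (0 : ℝ), HasDerivWithinAt w (v r) (Ici 0) r :=
    fun r hr => ((cw.differentiableOn one_ne_zero) r hr).hasDerivWithinAt
  have y0 : y 0 = 0 := by simp [hy, phiP, w0']
  have hN0 : (0 : ℝ) < N := by exact_mod_cast hN
  have h0 : (0 : ℝ) ∈ Ici (0 : ℝ) := self_mem_Ici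
  have dy0 : derivWithin y (Ici 0) 0 < 0 := by
    have l1 : Tendsto (derivWithin y (Ici 0)) (𝓝[>] 0) (𝓝 (derivWithin y (Ici 0) 0)) :=
      (cy' 0 h0).mono_left (nhdsWithin_mono _ Ioi_subset_Ici_self)
    have l2 : Tendsto (fun r => y r / r) (𝓝[>] 0) (𝓝 (derivWithin y (Ici 0) 0)) := by
      have := hasDerivWithinAt_iff_tendsto_slope.1 (dy 0 h0)
      rw [show Ici (0 : ℝ) \ {0} = Ioi 0 by ext; simp [lt_iff_le_and_ne, eq_comm]] at this
      refine this.congr fun r => ?_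
      simp [slope_def_field, y0]
    have l3 : Tendsto v (𝓝[>] 0) (𝓝 0) := by
      have := (cv 0 h0).mono_left (nhdsWithin_mono _ Ioi_subset_Ici_self)
      rwa [w0'] at this
    have l4 : Tendsto w (𝓝[>] 0) (𝓝 a) := by
      have := (cw.continuousOn 0 h0).mono_left (nhdsWithin_mono _ Ioi_subset_Ici_self)
      rwa [w0] at this
    have l5 : Tendsto (fun r : ℝ => r) (𝓝[>] 0) (𝓝 0) := tendsto_id.mono_left nhdsWithin_le_nhds
    have l6 := (((l1.add (l2.const_mul ((N : ℝ) - 1))).add (l5.mul l3)).add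
      (l4.const_mul α)).add ((l4.abs.rpow_const (p := q - 1) (Or.inr (by linarith))).mul l4)
    have l7 : Tendsto (fun _ : ℝ => (0 : ℝ)) (𝓝[>] 0) (𝓝 0) := tendsto_const_nhds
    have := tendsto_nhds_unique (l7.congr' ?_) l6
    · have h1 : 0 < |a| ^ (q - 1) * a := mul_pos (Real.rpow_pos_of_pos (abs_pos.2 ha.ne') _) ha
      have h2 : 0 < α * a := by positivity
      by_contra! hh
      nlinarith [mul_nonneg hN0.le hh]
    · filter_upwards [self_mem_nhdsWithin] with r hr
      have := heq r hr
      rw [div_mul_eq_mul_div, mul_div_assoc] at this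
      exact this.symm
  refine ⟨fun r => -y r, cw.continuousOn, w0, cy.continuousOn.neg, by simp [y0], ?_⟩
  intro R hR
  have key : ∀ r ∈ Ico 0 R, y r = 0 → derivWithin y (Ici 0) r < 0 := by
    intro r hr hyr
    rcases hr.1.eq_or_lt with rfl | hr0
    · exact dy0
    · have h1 := heq r hr0
      have h2 : v r = 0 := phiP_eq_zero hyr
      have h3 : phiP p (v r) = 0 := hyr
      have hwr := hR r hr
      have h4 : 0 < |w r| ^ (q - 1) * w r :=
        mul_pos (Real.rpow_pos_of_pos (abs_pos.2 hwr.ne') _) hwr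
      have h5 : 0 < α * w r := by positivity
      rw [h3, h2] at h1
      linarith
  have hle : ∀ r ∈ Ioo 0 R, y r ≤ 0 := by
    intro r hr
    refine image_le_of_deriv_right_lt_deriv_boundary (a := 0) (b := r) (f := y)
      (f' := derivWithin y (Ici 0)) (B := fun _ => 0) (B' := fun _ => 0)
      (cy.continuousOn.mono Icc_subset_Ici_self) ?_ y0.le (fun x => hasDerivAt_const x 0) ?_
      ⟨hr.1.le, le_rfl⟩
    · intro x hx
      exact (dy x hx.1).mono (Ici_subset_Ici.2 hx.1)
    · intro x hx hxy
      exact key x ⟨hx.1, hx.2.trans hr.2⟩ hxy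
  intro r hr
  have hn : Ici (0 : ℝ) ∈ 𝓝 r := Ici_mem_nhds hr.1
  have dyr := (dy r hr.1.le).hasDerivAt hn
  have dwr := (dw r hr.1.le).hasDerivAt hn
  have hneg : y r < 0 := by
    refine lt_of_le_of_ne (hle r hr) fun h => ?_
    have hmax : IsLocalMax y r := by
      filter_upwards [Ioo_mem_nhds hr.1 hr.2] with x hx
      rw [h]; exact hle x hx
    have := key r ⟨hr.1.le, hr.2⟩ h
    rw [hmax.hasDerivAt_eq_zero dyr] at this
    exact lt_irrefl _ this
  have hvr : v r = -(-y r) ^ (1 / (p - 1)) := eq_neg_rpow_of_phiP_neg hp hneg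
  refine ⟨by linarith, hvr ▸ dwr, dyr.neg.congr_deriv ?_⟩
  have h1 := heq r hr.1
  have hwr := hR r ⟨hr.1.le, hr.2⟩
  have h2 : |w r| ^ (q - 1) * w r = w r ^ q := by
    rw [abs_of_pos hwr, Real.rpow_sub_one hwr.ne']; field_simp
  have h3 : (-y r) ^ (1 / (p - 1)) = - v r := by linarith
  rw [h2] at h1
  rw [h3]
  change _ + _ * y r + _ + _ + _ = _ at h1
  linarith

/-- The autonomous form of equation (E) along a positive decreasing solution `w`: in the variable
`t = log r`, `x = w`, `s = |w'| ^ (p - 1) / (r * w)` and `k = r * |w'| / w`. -/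
structure LogFlow (n p q α : ℝ) (x s k : ℝ → ℝ) : Prop where
  x_pos : ∀ t, 0 < x t
  s_pos : ∀ t, 0 < s t
  k_pos : ∀ t, 0 < k t
  deriv_x : ∀ t, HasDerivAt x (-(k t * x t)) t
  deriv_s : ∀ t, HasDerivAt s (α + x t ^ (q - 1) - n * s t - (1 - s t) * k t) t
  deriv_k : ∀ t,
    HasDerivAt k (k t * (k t + (p - n + (α + x t ^ (q - 1) - k t) / s t) / (p - 1))) t
  k_rpow : ∀ t, k t ^ (p - 1) = Real.exp (p * t) * x t ^ (2 - p) * s t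

theorem logFlow_of_flux {n p q α : ℝ} {w ψ : ℝ → ℝ} (hp : 1 < p)
    (hw : ∀ r, 0 < r → 0 < w r)
    (hf : ∀ r, 0 < r → 0 < ψ r ∧
      HasDerivAt w (-(ψ r) ^ (1 / (p - 1))) r ∧
      HasDerivAt ψ (α * w r + w r ^ q - r * ψ r ^ (1 / (p - 1)) - (n - 1) / r * ψ r) r) :
    LogFlow n p q α (fun t => w (Real.exp t))
      (fun t => ψ (Real.exp t) / (Real.exp t * w (Real.exp t)))
      (fun t => Real.exp t * ψ (Real.exp t) ^ (1 / (p - 1)) / w (Real.exp t)) := by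
  have hp0 : p - 1 ≠ 0 := by linarith
  have dw : ∀ t, HasDerivAt (fun t => w (Real.exp t))
      (-ψ (Real.exp t) ^ (1 / (p - 1)) * Real.exp t) t := fun t =>
    (hf _ (Real.exp_pos t)).2.1.comp t (Real.hasDerivAt_exp t)
  have dψ := fun t => (hf _ (Real.exp_pos t)).2.2.comp t (Real.hasDerivAt_exp t)
  have ew : ∀ t, w (Real.exp t) ^ q = w (Real.exp t) * w (Real.exp t) ^ (q - 1) := fun t => by
    rw [Real.rpow_sub_one (hw _ (Real.exp_pos t)).ne']
    field_simp [(hw _ (Real.exp_pos t)).ne']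
  have pw : ∀ t, 0 < w (Real.exp t) := fun t => hw _ (Real.exp_pos t)
  have pψ : ∀ t, 0 < ψ (Real.exp t) := fun t => (hf _ (Real.exp_pos t)).1
  have pm : ∀ t, 0 < ψ (Real.exp t) ^ (1 / (p - 1)) := fun t => Real.rpow_pos_of_pos (pψ t) _
  refine ⟨pw, fun t => ?_, fun t => ?_, fun t => ?_, fun t => ?_, fun t => ?_, fun t => ?_⟩
  · have := pw t; have := pψ t; positivity
  · have := pw t; have := pm t; positivity
  · refine (dw t).congr_deriv ?_
    have := (pw t).ne'
    field_simp
  · have h0 : Real.exp t * w (Real.exp t) ≠ 0 := mul_ne_zero (Real.exp_pos t).ne' (pw t).ne'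
    refine ((dψ t).div ((Real.hasDerivAt_exp t).mul (dw t)) h0).congr_deriv ?_
    have h1 := (pw t).ne'
    have h2 := (Real.exp_pos t).ne'
    simp only [Function.comp_apply, Pi.mul_apply, ew]
    generalize ψ (Real.exp t) ^ (1 / (p - 1)) = m
    generalize w (Real.exp t) ^ (q - 1) = z
    field_simp
    ring
  · have d1 := (dψ t).rpow_const (p := 1 / (p - 1)) (Or.inl (pψ t).ne')
    refine (((Real.hasDerivAt_exp t).mul d1).div (dw t) (pw t).ne').congr_deriv ?_
    have h1 := (pw t).ne'
    have h2 := (Real.exp_pos t).ne'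
    have h3 := (pψ t).ne'
    simp only [Function.comp_apply, Pi.mul_apply, ew, Real.rpow_sub_one h3]
    generalize ψ (Real.exp t) ^ (1 / (p - 1)) = m
    generalize w (Real.exp t) ^ (q - 1) = z
    field_simp
    ring
  · have h1 := (pw t).ne'
    have h2 := (Real.exp_pos t).ne'
    have e1 : (ψ (Real.exp t) ^ (1 / (p - 1))) ^ (p - 1) = ψ (Real.exp t) := by
      rw [← Real.rpow_mul (pψ t).le, one_div_mul_cancel hp0, Real.rpow_one]
    have e2 : w (Real.exp t) ^ (2 - p) = w (Real.exp t) / w (Real.exp t) ^ (p - 1) := by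
      rw [show 2 - p = 1 - (p - 1) by ring, Real.rpow_sub (pw t), Real.rpow_one]
    have e3 : Real.exp (p * t) = Real.exp t ^ (p - 1) * Real.exp t := by
      rw [← Real.exp_mul, ← Real.exp_add]; ring_nf
    rw [Real.div_rpow (mul_pos (Real.exp_pos t) (pm t)).le (pw t).le,
      Real.mul_rpow (Real.exp_pos t).le (pm t).le, e1, e2, e3]
    field_simp

theorem pohozaev_exp {p q l σ e t : ℝ} {w ψ : ℝ → ℝ} (hp : 1 < p)
    (hw : 0 < w (Real.exp t)) (hψ : 0 < ψ (Real.exp t)) :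
    pohozaev p q l σ e w ψ (Real.exp t) = -(Real.exp (l * t) * w (Real.exp t) ^ 2 *
      (ψ (Real.exp t) / (Real.exp t * w (Real.exp t)) *
        (σ - Real.exp t * ψ (Real.exp t) ^ (1 / (p - 1)) / w (Real.exp t) / (p / (p - 1)))
        - e / 2 - w (Real.exp t) ^ (q - 1) / (q + 1))) := by
  have e1 : ψ (Real.exp t) ^ (p / (p - 1)) = ψ (Real.exp t) * ψ (Real.exp t) ^ (1 / (p - 1)) := by
    have : 1 / (p - 1) = p / (p - 1) - 1 := by
      have : p - 1 ≠ 0 := by linarith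
      field_simp; ring
    rw [this, Real.rpow_sub_one hψ.ne']; field_simp
  have e2 : w (Real.exp t) ^ (q + 1) = w (Real.exp t) ^ 2 * w (Real.exp t) ^ (q - 1) := by
    rw [show q + 1 = 2 + (q - 1) by ring, Real.rpow_add hw]; norm_num
  have e3 : Real.exp t ^ (l - 1) = Real.exp (l * t) / Real.exp t := by
    rw [← Real.exp_mul, ← Real.exp_sub]; ring_nf
  have e4 : Real.exp t ^ l = Real.exp (l * t) := by
    rw [← Real.exp_mul]; ring_nf
  rw [pohozaev, e1, e2, e3, e4]
  generalize ψ (Real.exp t) ^ (1 / (p - 1)) = m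
  generalize w (Real.exp t) ^ (q - 1) = z
  generalize Real.exp (l * t) = E
  have := (Real.exp_pos t).ne'
  generalize q + 1 = q'
  generalize p / (p - 1) = p'
  field_simp
  ring

theorem le_of_barrier {f f' : ℝ → ℝ} {M t₀ : ℝ} (hf : ∀ t, HasDerivAt f (f' t) t)
    (h0 : f t₀ ≤ M) (hM : ∀ t, t₀ ≤ t → f t = M → f' t < 0) : ∀ t, t₀ ≤ t → f t ≤ M := by
  intro t ht
  exact image_le_of_deriv_right_lt_deriv_boundary (a := t₀) (b := t) (f := f)
    (f' := f') (B := fun _ => M) (B' := fun _ => 0)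
    (fun x _ => (hf x).continuousAt.continuousWithinAt)
    (fun x _ => (hf x).hasDerivWithinAt) h0 (fun x => hasDerivAt_const x M)
    (fun x hx h => hM x hx.1 h) ⟨ht, le_rfl⟩

namespace LogFlow

variable {n p q α : ℝ} {x s k : ℝ → ℝ}

theorem antitone_x (h : LogFlow n p q α x s k) : Antitone x :=
  antitone_of_deriv_nonpos (fun t => (h.deriv_x t).differentiableAt) fun t => by
    rw [(h.deriv_x t).deriv]
    have := h.x_pos t; have := h.k_pos t
    exact neg_nonpos.2 (by positivity)

theorem k_bounded (h : LogFlow n p q α x s k) (hp : 1 < p) (hq : 1 < q) (hα : 0 < α) (hn : 0 ≤ n)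
    {σ e : ℝ} (hσ : 0 < σ)
    (hW : ∀ t, 0 ≤ t → 0 < s t * (σ - k t / (p / (p - 1))) - e / 2 - x t ^ (q - 1) / (q + 1)) :
    ∃ K, ∀ t, 0 ≤ t → k t ≤ K := by
  have hpp : 0 < p / (p - 1) := div_pos (by linarith) (by linarith)
  set P := p / (p - 1)
  set C := P * |e| + 1 with hC
  have hC0 : 0 < C := by positivity
  set G := x 0 ^ (q - 1) with hG
  have hG0 : 0 < G := Real.rpow_pos_of_pos (h.x_pos 0) _
  set K := k 0 + 2 * P * σ + 2 * (α + G) + 4 * C * p + 1 with hK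
  have k0 := h.k_pos 0
  have a1 : 0 < P * σ := by positivity
  have a2 : 0 < C * p := by positivity
  refine ⟨K, le_of_barrier h.deriv_k (by linarith) fun t ht hkt => ?_⟩
  have hk := h.k_pos t
  have hs := h.s_pos t
  have hg : x t ^ (q - 1) ≤ G :=
    Real.rpow_le_rpow (h.x_pos t).le (h.antitone_x ht) (by linarith)
  have hg0 : 0 < x t ^ (q - 1) := Real.rpow_pos_of_pos (h.x_pos t) _
  have hWt := hW t ht
  generalize x t ^ (q - 1) = g at *
  have b1 : 2 * P * σ ≤ k t := by linarith
  have b2 : 2 * (α + G) ≤ k t := by linarith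
  have b3 : 4 * C * p ≤ k t := by linarith
  have b4 : 1 ≤ k t := by linarith
  have hsk : s t * k t ≤ C := by
    have h1 : k t / (2 * P) ≤ k t / P - σ := by
      rw [div_sub' hpp.ne', div_le_div_iff₀ (by positivity) hpp]
      nlinarith [mul_le_mul_of_nonneg_left b1 hpp.le]
    have h2 : s t * (k t / (2 * P)) ≤ |e| / 2 := by
      have := mul_le_mul_of_nonneg_left h1 hs.le
      have h3 : 0 < g / (q + 1) := div_pos hg0 (by linarith)
      have := neg_abs_le e
      linarith
    have h4 : s t * k t = 2 * P * (s t * (k t / (2 * P))) := by field_simp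
    rw [h4, hC]
    nlinarith [mul_le_mul_of_nonneg_left h2 (show 0 ≤ 2 * P by positivity)]
  refine mul_neg_of_pos_of_neg hk ?_
  have h5 : (α + g - k t) / s t ≤ -(2 * p * k t) := by
    rw [div_le_iff₀ hs]
    nlinarith [mul_le_mul_of_nonneg_left hsk (show 0 ≤ p by linarith)]
  have h6 : (p - n + (α + g - k t) / s t) < -(k t * (p - 1)) := by nlinarith
  have h7 := (div_lt_iff₀ (show 0 < p - 1 by linarith)).2 (by rw [neg_mul]; exact h6)
  linarith

theorem exists_tendsto (h : LogFlow n p q α x s k) (hq : 1 < q) (hα : 0 < α) (hn : 0 < n)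
    {C ε T : ℝ} (hε : 0 < ε) (hs : ∀ t, T ≤ t → s t ≤ C * Real.exp (-ε * t)) :
    ∃ L, 0 < L ∧ Tendsto (fun t => Real.exp (α * t) * x t) atTop (𝓝 L) := by
  have hexp : ∀ c : ℝ, 0 < c → Tendsto (fun t => Real.exp (-c * t)) atTop (𝓝 0) := fun c hc =>
    Real.tendsto_exp_atBot.comp (tendsto_id.const_mul_atTop_of_neg (neg_neg_of_pos hc))
  have hs0 : Tendsto s atTop (𝓝 0) := by
    have := (hexp ε hε).const_mul C
    rw [mul_zero] at this
    exact squeeze_zero' (Eventually.of_forall fun t => (h.s_pos t).le)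
      ((eventually_ge_atTop T).mono hs) this
  obtain ⟨T₁, hT₁⟩ := eventually_atTop.1
    ((hs0.eventually_lt_const (show (0 : ℝ) < 1 / 2 by norm_num)).and
      (hs0.eventually_lt_const (show 0 < α / (2 * n) by positivity)))
  have hs2 : ∀ t, T₁ ≤ t → s t < 1 / 2 := fun t ht => (hT₁ t ht).1
  have hs3 : ∀ t, T₁ ≤ t → n * s t < α / 2 := fun t ht => by
    have := (lt_div_iff₀ (show 0 < 2 * n by positivity)).1 (hT₁ t ht).2
    linarith
  have du : ∀ t, HasDerivAt (fun t => x t * (1 - s t))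
      (-(x t * (α + x t ^ (q - 1) - n * s t))) t := fun t =>
    ((h.deriv_x t).mul ((h.deriv_s t).const_sub 1)).congr_deriv (by ring)
  -- exponential decay of `x * (1 - s)`
  have hanti : AntitoneOn (fun t => Real.exp (α / 2 * t) * (x t * (1 - s t))) (Ici T₁) := by
    have hd : ∀ t, HasDerivAt (fun t => Real.exp (α / 2 * t) * (x t * (1 - s t))) _ t := fun t =>
      (((hasDerivAt_id t).const_mul (α / 2)).exp).mul (du t)
    refine antitoneOn_of_deriv_nonpos (convex_Ici _)
      (fun t _ => (hd t).continuousAt.continuousWithinAt)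
      (fun t _ => (hd t).differentiableAt.differentiableWithinAt) fun t ht => ?_
    rw [interior_Ici] at ht
    rw [(hd t).deriv]
    have h1 := hs3 t ht.le
    have h2 := h.x_pos t
    have h3 := h.s_pos t
    have h4 := Real.rpow_pos_of_pos h2 (q - 1)
    have : 0 ≤ Real.exp (α / 2 * t) * (x t * (α / 2 * s t + (α / 2 - n * s t) + x t ^ (q - 1))) := by
      have : 0 < α / 2 - n * s t := by linarith
      positivity
    simp only [id]
    linarith
  set U := Real.exp (α / 2 * T₁) * (x T₁ * (1 - s T₁)) with hU
  have hU0 : 0 < U := by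
    have := hs2 T₁ le_rfl
    have := h.x_pos T₁
    have : 0 < 1 - s T₁ := by linarith
    positivity
  have hx : ∀ t, T₁ ≤ t → x t ≤ 2 * U * Real.exp (-(α / 2) * t) := fun t ht => by
    have h1 : Real.exp (α / 2 * t) * (x t * (1 - s t)) ≤ U := hanti self_mem_Ici ht ht
    have h2 := hs2 t ht
    have h3 : Real.exp (α / 2 * t) * x t ≤ 2 * U := by
      have : 0 < Real.exp (α / 2 * t) * x t := mul_pos (Real.exp_pos _) (h.x_pos t)
      nlinarith
    rw [neg_mul, Real.exp_neg, ← div_eq_mul_inv, le_div_iff₀ (Real.exp_pos _)]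
    linarith
  have hg : ∀ t, T₁ ≤ t →
      x t ^ (q - 1) ≤ (2 * U) ^ (q - 1) * Real.exp (-(α / 2 * (q - 1)) * t) := fun t ht => by
    have := Real.rpow_le_rpow (h.x_pos t).le (hx t ht) (show 0 ≤ q - 1 by linarith)
    rw [Real.mul_rpow (by positivity) (Real.exp_pos _).le, ← Real.exp_mul] at this
    convert this using 3
    ring
  -- convergence of `α * t + log x + log (1 - s)`
  set T₂ := max T T₁ with hT₂
  have hder : ∀ t ∈ Ici T₂,
      HasDerivAt (fun t => α * t + Real.log (x t * (1 - s t)))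
        (((n - α) * s t - x t ^ (q - 1)) / (1 - s t)) t := fun t ht => by
    have h2 : 0 < 1 - s t := by linarith [hs2 t ((le_max_right _ _).trans ht)]
    have h1 := h.x_pos t
    refine (((hasDerivAt_id t).const_mul α).add ((du t).log (mul_pos h1 h2).ne')).congr_deriv ?_
    field_simp
    ring
  have hcont : ContinuousOn (fun t => ((n - α) * s t - x t ^ (q - 1)) / (1 - s t)) (Ici T₂) := by
    have cs : Continuous s := continuous_iff_continuousAt.2 fun t => (h.deriv_s t).continuousAt
    have cx : Continuous x := continuous_iff_continuousAt.2 fun t => (h.deriv_x t).continuousAt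
    refine ContinuousOn.div ((continuous_const.mul cs).sub
      (cx.rpow_const fun t => Or.inl (h.x_pos t).ne')).continuousOn
      (continuous_const.sub cs).continuousOn fun t ht => ?_
    linarith [hs2 t ((le_max_right _ _).trans ht)]
  have hint : MeasureTheory.IntegrableOn
      (fun t => ((n - α) * s t - x t ^ (q - 1)) / (1 - s t)) (Ioi T₂) := by
    have hβ : 0 < α / 2 * (q - 1) := mul_pos (by positivity) (by linarith)
    have i1 := ((integrableOn_exp_mul_Ioi (neg_neg_of_pos hε) T₂).const_mul (2 * (|n - α| * C))).add
      ((integrableOn_exp_mul_Ioi (neg_neg_of_pos hβ) T₂).const_mul (2 * (2 * U) ^ (q - 1)))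
    refine MeasureTheory.Integrable.mono' i1
      ((hcont.mono Ioi_subset_Ici_self).aestronglyMeasurable measurableSet_Ioi) ?_
    refine (MeasureTheory.ae_restrict_iff' measurableSet_Ioi).2 (Eventually.of_forall ?_)
    intro t ht
    have ht1 : T₁ ≤ t := (le_max_right _ _).trans (le_of_lt ht)
    have ht0 : T ≤ t := (le_max_left _ _).trans (le_of_lt ht)
    have h2 : 1 / 2 < 1 - s t := by linarith [hs2 t ht1]
    have h4 := Real.rpow_pos_of_pos (h.x_pos t) (q - 1)
    rw [Real.norm_eq_abs, abs_div, abs_of_pos (show 0 < 1 - s t by linarith),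
      div_le_iff₀ (by linarith)]
    have b1 : |(n - α) * s t - x t ^ (q - 1)| ≤ |n - α| * s t + x t ^ (q - 1) := by
      refine (abs_sub _ _).trans ?_
      rw [abs_mul, abs_of_pos (h.s_pos t), abs_of_pos h4]
    have b2 := mul_le_mul_of_nonneg_left (hs t ht0) (abs_nonneg (n - α))
    have b3 := hg t ht1
    have b4 : 0 ≤ |n - α| * s t := mul_nonneg (abs_nonneg _) (h.s_pos t).le
    refine b1.trans ?_
    simp only [Pi.add_apply]
    nlinarith
  obtain ⟨ℓ, hlim⟩ : ∃ ℓ, Tendsto (fun t => α * t + Real.log (x t * (1 - s t))) atTop (𝓝 ℓ) :=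
    ⟨_, MeasureTheory.tendsto_limUnder_of_hasDerivAt_of_integrableOn_Ioi
      (fun t ht => hder t (Ioi_subset_Ici_self ht)) hint⟩
  refine ⟨Real.exp ℓ, Real.exp_pos _, ?_⟩
  have l1 : Tendsto (fun t => 1 - s t) atTop (𝓝 1) := by simpa using hs0.const_sub 1
  have l2 := ((Real.continuous_exp.tendsto _).comp hlim).div l1 one_ne_zero
  rw [div_one] at l2
  refine l2.congr' ?_
  filter_upwards [eventually_ge_atTop T₁] with t ht
  have h2 : 0 < 1 - s t := by linarith [hs2 t ht]
  simp only [Pi.div_apply, Function.comp_apply]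
  rw [Real.exp_add, Real.exp_log (mul_pos (h.x_pos t) h2)]
  field_simp

theorem s_decay_of_le (h : LogFlow n p q α x s k) (hp : 1 < p) {K c ε T : ℝ} (hc : 0 < c)
    (hK : ∀ t, T ≤ t → k t ≤ K)
    (hA : ∀ t, T ≤ t → c * Real.exp (ε * t) ≤ Real.exp (p * t) * x t ^ (2 - p)) :
    ∀ t, T ≤ t → s t ≤ K ^ (p - 1) / c * Real.exp (-ε * t) := by
  intro t ht
  have h1 := hA t ht
  have h2 := Real.rpow_le_rpow (h.k_pos t).le (hK t ht) (show 0 ≤ p - 1 by linarith)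
  rw [h.k_rpow t] at h2
  have h3 := (mul_le_mul_of_nonneg_right h1 (h.s_pos t).le).trans h2
  rw [neg_mul, Real.exp_neg, ← div_eq_mul_inv, div_div, le_div_iff₀ (by positivity)]
  linarith

theorem s_decay_of_two_lt (h : LogFlow n p q α x s k) (hp : 2 < p) {K : ℝ}
    (hK : ∀ t, 0 ≤ t → k t ≤ K) :
    ∃ C ε T : ℝ, 0 < ε ∧ ∀ t, T ≤ t → s t ≤ C * Real.exp (-ε * t) := by
  refine ⟨_, p, 0, by linarith, h.s_decay_of_le (by linarith)
    (Real.rpow_pos_of_pos (h.x_pos 0) (2 - p)) hK fun t ht => ?_⟩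
  rw [mul_comm]
  exact mul_le_mul_of_nonneg_left
    (Real.rpow_le_rpow_of_nonpos (h.x_pos t) (h.antitone_x ht) (by linarith)) (Real.exp_pos _).le

theorem s_decay_of_lt_two (h : LogFlow n p q α x s k) (hp : 1 < p) (hp2 : p < 2) (hq : 1 < q)
    {K l σ e c : ℝ} (hσ : 0 < σ) (hl : l * (2 - p) < 2 * p) (hc : 0 < c)
    (hK : ∀ t, 0 ≤ t → k t ≤ K)
    (hW : ∀ t, 0 ≤ t → c ≤ Real.exp (l * t) * x t ^ 2 *
      (s t * (σ - k t / (p / (p - 1))) - e / 2 - x t ^ (q - 1) / (q + 1))) :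
    ∃ C ε T : ℝ, 0 < ε ∧ ∀ t, T ≤ t → s t ≤ C * Real.exp (-ε * t) := by
  have hpp : 0 < p / (p - 1) := div_pos (by linarith) (by linarith)
  set A := fun t => Real.exp (p * t) * x t ^ (2 - p) with hA
  have A0 : ∀ t, 0 < A t := fun t =>
    mul_pos (Real.exp_pos _) (Real.rpow_pos_of_pos (h.x_pos t) _)
  have h2p : 0 < 2 - p := by linarith
  set y := 2 / (2 - p) with hy
  have hy1 : 1 ≤ y := by rw [hy, le_div_iff₀ h2p]; linarith
  have hy0 : 0 < y := by linarith
  set η := y * p - l with hη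
  have hη0 : 0 < η := by
    have : l < 2 * p / (2 - p) := (lt_div_iff₀ h2p).2 hl
    have e1 : 2 * p / (2 - p) = y * p := by rw [hy]; ring
    linarith
  set B := K ^ (p - 1) with hB
  have hK0 : 0 < K := (h.k_pos 0).trans_le (hK 0 le_rfl)
  have hB0 : 0 < B := Real.rpow_pos_of_pos hK0 _
  set D := σ * B + |e| / 2 with hD
  have hD0 : 0 < D := by positivity
  have key : ∀ t, 0 ≤ t → c * Real.exp (η * t) ≤ A t ^ y * (σ * B / A t + |e| / 2) := by
    intro t ht
    have eA : A t ^ y = Real.exp (η * t) * (Real.exp (l * t) * x t ^ 2) := by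
      rw [hA, Real.mul_rpow (Real.exp_pos _).le (Real.rpow_nonneg (h.x_pos t).le _),
        ← Real.exp_mul, ← Real.rpow_mul (h.x_pos t).le, ← mul_assoc, ← Real.exp_add]
      congr 1
      · congr 1; rw [hη]; ring
      · rw [hy, mul_div_cancel₀ _ h2p.ne', Real.rpow_two]
    have hs : s t ≤ B / A t := by
      rw [le_div_iff₀ (A0 t), mul_comm, hA, ← h.k_rpow t]
      exact Real.rpow_le_rpow (h.k_pos t).le (hK t ht) (by linarith)
    rw [eA, mul_comm c, mul_assoc]
    refine mul_le_mul_of_nonneg_left ((hW t ht).trans ?_) (Real.exp_pos _).le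
    refine mul_le_mul_of_nonneg_left ?_ (by have := h.x_pos t; positivity)
    have b1 : 0 < s t * (k t / (p / (p - 1))) := by
      have := h.s_pos t; have := h.k_pos t; positivity
    have b2 : 0 < x t ^ (q - 1) / (q + 1) :=
      div_pos (Real.rpow_pos_of_pos (h.x_pos t) _) (by linarith)
    have b3 := mul_le_mul_of_nonneg_left hs hσ.le
    have b4 := neg_abs_le e
    rw [mul_div_assoc]
    linarith
  obtain ⟨T, hT⟩ : ∃ T, ∀ t, T ≤ t → D < c * Real.exp (η * t) :=
    eventually_atTop.1 (((Real.tendsto_exp_atTop.comp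
      (tendsto_id.const_mul_atTop hη0)).const_mul_atTop hc).eventually_gt_atTop D)
  have hA1 : ∀ t, max T 0 ≤ t → 1 < A t := by
    intro t ht
    by_contra! hle
    have k1 := key t ((le_max_right _ _).trans ht)
    have k2 := hT t ((le_max_left _ _).trans ht)
    have k3 : A t ^ y ≤ 1 := Real.rpow_le_one (A0 t).le hle hy0.le
    have k4 : A t ^ y / A t ≤ 1 := by
      rw [← Real.rpow_sub_one (A0 t).ne']
      exact Real.rpow_le_one (A0 t).le hle (by linarith)
    have k5 : A t ^ y * (σ * B / A t + |e| / 2)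
        = σ * B * (A t ^ y / A t) + |e| / 2 * A t ^ y := by ring
    have k6 := mul_le_mul_of_nonneg_left k4 (show 0 ≤ σ * B by positivity)
    have k7 := mul_le_mul_of_nonneg_left k3 (show 0 ≤ |e| / 2 by positivity)
    linarith
  refine ⟨_, η / y, max T 0, by positivity, h.s_decay_of_le hp (c := (c / D) ^ (1 / y))
    (Real.rpow_pos_of_pos (by positivity) _) (fun t ht => hK t ((le_max_right _ _).trans ht))
    fun t ht => ?_⟩
  have k1 := key t ((le_max_right _ _).trans ht)
  have k2 : σ * B / A t ≤ σ * B := div_le_self (by positivity) (hA1 t ht).le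
  have k3 : c / D * Real.exp (η * t) ≤ A t ^ y := by
    rw [div_mul_eq_mul_div, div_le_iff₀ hD0]
    exact k1.trans (mul_le_mul_of_nonneg_left (by linarith) (Real.rpow_nonneg (A0 t).le _))
  have k4 := Real.rpow_le_rpow (by positivity) k3 (show 0 ≤ 1 / y by positivity)
  rw [← Real.rpow_mul (A0 t).le, mul_one_div_cancel hy0.ne', Real.rpow_one,
    Real.mul_rpow (by positivity) (Real.exp_pos _).le, ← Real.exp_mul] at k4
  convert k4 using 3
  field_simp

theorem tendsto_x_zero (h : LogFlow n p q α x s k) (hα : 0 < α) (hn : 0 < n)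
    {M : ℝ} (hM : ∀ t, 0 ≤ t → s t * x t ≤ M * Real.exp (-t)) :
    Tendsto x atTop (𝓝 0) := by
  have hM0 : 0 ≤ M := by
    have := hM 0 le_rfl
    have := mul_pos (h.s_pos 0) (h.x_pos 0)
    simp at *
    linarith
  suffices H : ∀ b > 0, ∃ T, x T < b by
    rw [tendsto_order]
    refine ⟨fun b hb => Eventually.of_forall fun t => hb.trans (h.x_pos t), fun b hb => ?_⟩
    obtain ⟨T, hT⟩ := H b hb
    filter_upwards [eventually_ge_atTop T] with t ht
    exact (h.antitone_x ht).trans_lt hT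
  intro b hb
  by_contra! hx
  have hab : 0 < α * b := by positivity
  have du : ∀ t, HasDerivAt (fun t => x t * (1 - s t) + α * b * t + n * M * Real.exp (-t))
      (-(x t * (α + x t ^ (q - 1) - n * s t)) + α * b - n * M * Real.exp (-t)) t := by
    intro t
    refine ((((h.deriv_x t).mul ((h.deriv_s t).const_sub 1)).add
      ((hasDerivAt_id t).const_mul (α * b))).add
      (((hasDerivAt_neg t).exp).const_mul (n * M))).congr_deriv (by ring)
  have hanti : AntitoneOn
      (fun t => x t * (1 - s t) + α * b * t + n * M * Real.exp (-t)) (Ici 0) := by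
    refine antitoneOn_of_deriv_nonpos (convex_Ici _)
      (fun t _ => (du t).continuousAt.continuousWithinAt)
      (fun t _ => (du t).differentiableAt.differentiableWithinAt) fun t ht => ?_
    rw [interior_Ici] at ht
    rw [(du t).deriv]
    have h1 := mul_le_mul_of_nonneg_left (hM t (le_of_lt ht)) hn.le
    have h2 := mul_le_mul_of_nonneg_left (hx t) hα.le
    have h3 := mul_pos (h.x_pos t) (Real.rpow_pos_of_pos (h.x_pos t) (q - 1))
    linarith
  set F := x 0 * (1 - s 0) + α * b * 0 + n * M * Real.exp (-0) with hF
  set t := (|F| + M + 1) / (α * b) with ht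
  have ht0 : 0 ≤ t := by positivity
  have h1 : x t * (1 - s t) + α * b * t + n * M * Real.exp (-t) ≤ F := hanti self_mem_Ici ht0 ht0
  have h2 : α * b * t = |F| + M + 1 := by rw [ht]; field_simp
  have h3 : s t * x t ≤ M :=
    (hM t ht0).trans (mul_le_of_le_one_right hM0 (Real.exp_le_one_iff.2 (by linarith)))
  have h4 : 0 ≤ n * M * Real.exp (-t) := by positivity
  have h5 := le_abs_self F
  have h6 := h.x_pos t
  linarith

theorem s_decay_of_critical (h : LogFlow n p q α x s k) (hp : 1 < p) (hp2 : p < 2) (hq : 1 < q)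
    (hα : α < p / (2 - p)) (hδ : p / (2 - p) ≤ n / 2)
    (hκ : p / (p - 1) * (n / 2) ≤ (n - p) / (p - 1)) (hα0 : 0 < α)
    (hx : Tendsto x atTop (𝓝 0)) {c : ℝ} (hc : 0 < c)
    (hW : ∀ t, 0 ≤ t → c ≤ Real.exp (n * t) * x t ^ 2 *
      (s t * (n / 2 - k t / (p / (p - 1))) - (α - n / 2) / 2 - x t ^ (q - 1) / (q + 1))) :
    ∃ C ε T : ℝ, 0 < ε ∧ ∀ t, T ≤ t → s t ≤ C * Real.exp (-ε * t) := by
  have hp0 : 0 < p - 1 := by linarith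
  have h2p : 0 < 2 - p := by linarith
  have hpp1 : 1 < p / (p - 1) := by rw [lt_div_iff₀ hp0]; linarith
  set P := p / (p - 1) with hP
  have hP0 : 0 < P := by linarith
  set δ := p / (2 - p) with hδdef
  set κ := (n - p) / (p - 1) with hκdef
  have hn0 : 0 < n := by linarith
  have hnκ : n / 2 < κ := by nlinarith
  set b := (α + δ) / 2 with hb
  have hαb : α < b := by linarith
  have hbδ : b < δ := by linarith
  have hb0 : 0 < b := by linarith
  have hg : Tendsto (fun t => x t ^ (q - 1)) atTop (𝓝 0) := by
    have := hx.rpow_const (p := q - 1) (Or.inr (by linarith))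
    rwa [Real.zero_rpow (by linarith)] at this
  obtain ⟨T₀, hT₀⟩ := eventually_atTop.1 (hg.eventually_lt_const (show 0 < b - α by linarith))
  set T := max T₀ 0 with hTdef
  have hgT : ∀ t, T ≤ t → x t ^ (q - 1) < b - α := fun t ht => hT₀ t ((le_max_left _ _).trans ht)
  have hT0 : 0 ≤ T := le_max_right _ _
  have hder : ∀ t, T ≤ t → b ≤ k t →
      k t * (k t + (p - n + (α + x t ^ (q - 1) - k t) / s t) / (p - 1)) < k t * (k t - κ) := by
    intro t ht hbk
    refine mul_lt_mul_of_pos_left ?_ (h.k_pos t)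
    have h1 : (α + x t ^ (q - 1) - k t) / s t < 0 :=
      div_neg_of_neg_of_pos (by linarith [hgT t ht]) (h.s_pos t)
    have h2 : (p - n + (α + x t ^ (q - 1) - k t) / s t) / (p - 1) < (p - n) / (p - 1) :=
      div_lt_div_of_pos_right (by linarith) hp0
    have h3 : (p - n) / (p - 1) = -κ := by rw [hκdef]; ring
    linarith
  obtain ⟨T₁, hT₁, hkT₁⟩ : ∃ T₁, T ≤ T₁ ∧ k T₁ ≤ b := by
    by_contra! hk
    have hkκ : ∀ t, T ≤ t → κ ≤ k t := by
      intro t₁ ht₁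
      by_contra! hlt
      have hle : ∀ t, t₁ ≤ t → k t ≤ k t₁ := le_of_barrier h.deriv_k le_rfl fun t ht hkt =>
        (hder t (ht₁.trans ht) (hk t (ht₁.trans ht)).le).trans
          (mul_neg_of_pos_of_neg (h.k_pos t) (by linarith))
      set ρ := b * (κ - k t₁) with hρ
      have hρ0 : 0 < ρ := mul_pos hb0 (by linarith)
      have hdk : ∀ t, HasDerivAt (fun t => k t + ρ * t)
          (k t * (k t + (p - n + (α + x t ^ (q - 1) - k t) / s t) / (p - 1)) + ρ * 1) t :=
        fun t => (h.deriv_k t).add ((hasDerivAt_id t).const_mul ρ)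
      have hanti : AntitoneOn (fun t => k t + ρ * t) (Ici t₁) := by
        refine antitoneOn_of_deriv_nonpos (convex_Ici _)
          (fun t _ => (hdk t).continuousAt.continuousWithinAt)
          (fun t _ => (hdk t).differentiableAt.differentiableWithinAt) fun t ht => ?_
        rw [interior_Ici] at ht
        have ht : t₁ < t := ht
        rw [(hdk t).deriv]
        have h1 := hder t (ht₁.trans ht.le) (hk t (ht₁.trans ht.le)).le
        have h2 := hle t ht.le
        have h3 := hk t (ht₁.trans ht.le)
        have h4 : ρ ≤ k t * (κ - k t) := by
          rw [hρ]
          exact mul_le_mul h3.le (by linarith) (by linarith) (h.k_pos t).le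
        linarith
      have h5 : t₁ ≤ t₁ + k t₁ / ρ := le_add_of_nonneg_right (div_nonneg (h.k_pos _).le hρ0.le)
      have h6 := hanti self_mem_Ici h5 h5
      have h7 := h.k_pos (t₁ + k t₁ / ρ)
      have h8 : ρ * (t₁ + k t₁ / ρ) = ρ * t₁ + k t₁ := by field_simp
      simp only [h8] at h6
      linarith
    set ν := 2 * κ - n with hν
    have hν0 : 0 < ν := by linarith
    have hdD : ∀ t, HasDerivAt (fun t => Real.exp (ν * t) * (Real.exp (n * t) * x t ^ 2))
        ((2 * (κ - k t)) * (Real.exp (ν * t) * (Real.exp (n * t) * x t ^ 2))) t := fun t =>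
      ((((hasDerivAt_id t).const_mul ν).exp).mul ((((hasDerivAt_id t).const_mul n).exp).mul
        ((h.deriv_x t).pow 2))).congr_deriv (by simp; ring)
    have hanti : AntitoneOn (fun t => Real.exp (ν * t) * (Real.exp (n * t) * x t ^ 2)) (Ici T) := by
      refine antitoneOn_of_deriv_nonpos (convex_Ici _)
        (fun t _ => (hdD t).continuousAt.continuousWithinAt)
        (fun t _ => (hdD t).differentiableAt.differentiableWithinAt) fun t ht => ?_
      rw [interior_Ici] at ht
      rw [(hdD t).deriv]
      have := hkκ t (le_of_lt ht)
      exact mul_nonpos_of_nonpos_of_nonneg (by linarith) (by positivity)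
    set F := Real.exp (ν * T) * (Real.exp (n * T) * x T ^ 2) with hF
    obtain ⟨t, ht, hlt⟩ := ((eventually_ge_atTop T).and (((Real.tendsto_exp_atTop.comp
      (tendsto_id.const_mul_atTop hν0)).const_mul_atTop hc).eventually_gt_atTop (F * (n / 2)))).exists
    have hlt : F * (n / 2) < c * Real.exp (ν * t) := hlt
    have h1 := hW t (hT0.trans ht)
    have h2 : s t * (n / 2 - k t / P) - (α - n / 2) / 2 - x t ^ (q - 1) / (q + 1) ≤ n / 2 := by
      have h3 : n / 2 ≤ k t / P := by
        rw [le_div_iff₀ hP0]; linarith [hkκ t ht]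
      have h4 : s t * (n / 2 - k t / P) ≤ 0 :=
        mul_nonpos_of_nonneg_of_nonpos (h.s_pos t).le (by linarith)
      have h5 : 0 < x t ^ (q - 1) / (q + 1) :=
        div_pos (Real.rpow_pos_of_pos (h.x_pos t) _) (by linarith)
      linarith
    have h6 : c ≤ Real.exp (n * t) * x t ^ 2 * (n / 2) :=
      h1.trans (mul_le_mul_of_nonneg_left h2 (by positivity))
    have h7 : Real.exp (ν * t) * (Real.exp (n * t) * x t ^ 2) ≤ F := hanti self_mem_Ici ht ht
    have h8 := mul_le_mul_of_nonneg_left h6 (Real.exp_pos (ν * t)).le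
    have h9 := mul_le_mul_of_nonneg_right h7 (show 0 ≤ n / 2 by linarith)
    linarith
  have hkb : ∀ t, T₁ ≤ t → k t ≤ b := le_of_barrier h.deriv_k hkT₁ fun t ht hkt =>
    (hder t (hT₁.trans ht) hkt.ge).trans (mul_neg_of_pos_of_neg (h.k_pos t) (by linarith))
  have hdx : ∀ t, HasDerivAt (fun t => Real.exp (b * t) * x t)
      ((b - k t) * (Real.exp (b * t) * x t)) t := fun t =>
    ((((hasDerivAt_id t).const_mul b).exp).mul (h.deriv_x t)).congr_deriv (by simp; ring)
  have hmono : MonotoneOn (fun t => Real.exp (b * t) * x t) (Ici T₁) := by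
    refine monotoneOn_of_deriv_nonneg (convex_Ici _)
      (fun t _ => (hdx t).continuousAt.continuousWithinAt)
      (fun t _ => (hdx t).differentiableAt.differentiableWithinAt) fun t ht => ?_
    rw [interior_Ici] at ht
    rw [(hdx t).deriv]
    have := hkb t (le_of_lt ht)
    have := h.x_pos t
    exact mul_nonneg (by linarith) (by positivity)
  set F := Real.exp (b * T₁) * x T₁ with hF
  have hF0 : 0 < F := mul_pos (Real.exp_pos _) (h.x_pos _)
  refine ⟨_, p - b * (2 - p), T₁, ?_, h.s_decay_of_le hp (c := F ^ (2 - p))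
    (Real.rpow_pos_of_pos hF0 _) hkb fun t ht => ?_⟩
  · have := (lt_div_iff₀ h2p).1 hbδ
    linarith
  · have h1 := Real.rpow_le_rpow hF0.le (hmono self_mem_Ici ht ht) h2p.le
    simp only [] at h1
    rw [Real.mul_rpow (Real.exp_pos _).le (h.x_pos t).le, ← Real.exp_mul] at h1
    have h2 := mul_le_mul_of_nonneg_right h1 (Real.exp_pos ((p - b * (2 - p)) * t)).le
    refine h2.trans_eq ?_
    have : p * t = b * t * (2 - p) + (p - b * (2 - p)) * t := by ring
    rw [this, Real.exp_add]
    ring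

end LogFlow

theorem exists_flux_bound {n p q α : ℝ} {w ψ : ℝ → ℝ} (hp : 1 < p) (hq : 1 < q) (hα : 0 < α)
    (hn : 1 ≤ n) (hw : ∀ r, 0 < r → 0 < w r)
    (hf : ∀ r, 0 < r → 0 < ψ r ∧
      HasDerivAt w (-(ψ r) ^ (1 / (p - 1))) r ∧
      HasDerivAt ψ (α * w r + w r ^ q - r * ψ r ^ (1 / (p - 1)) - (n - 1) / r * ψ r) r) :
    ∃ M, ∀ r, 1 ≤ r → ψ r ≤ M := by
  have hpp : 0 < p / (p - 1) := div_pos (by linarith) (by linarith)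
  set E := pohozaev p q 0 0 α w ψ with hE
  have dE := fun r (hr : 0 < r) => hasDerivAt_pohozaev (l := 0) (σ := 0) (e := α) hp hq hr (hw r hr)
    (hf r hr).1 (hf r hr).2.1 (hf r hr).2.2
  have hanti : AntitoneOn E (Ici 1) := by
    refine antitoneOn_of_deriv_nonpos (convex_Ici _)
      (fun r hr => (dE r (one_pos.trans_le hr)).continuousAt.continuousWithinAt)
      (fun r hr => ?_) fun r hr => ?_
    · rw [interior_Ici] at hr
      exact (dE r (one_pos.trans hr)).differentiableAt.differentiableWithinAt
    · rw [interior_Ici] at hr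
      have hr0 : 0 < r := one_pos.trans hr
      rw [(dE r hr0).deriv]
      refine neg_nonpos.2 (mul_nonneg (Real.rpow_nonneg hr0.le _) ?_)
      have h1 := (hf r hr0).1
      have h2 := Real.rpow_pos_of_pos h1 (1 / (p - 1))
      simp only [zero_div, sub_zero, zero_mul, add_zero, sub_self]
      have : 0 ≤ n - 1 := by linarith
      positivity
  refine ⟨(E 1 * (p / (p - 1))) ^ (1 / (p / (p - 1))), fun r hr => ?_⟩
  have hr0 : 0 < r := one_pos.trans_le hr
  have hψ := (hf r hr0).1
  have hwr := hw r hr0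
  have h1 : E r ≤ E 1 := hanti self_mem_Ici hr hr
  have h2 : ψ r ^ (p / (p - 1)) / (p / (p - 1)) ≤ E r := by
    have : 0 < w r ^ (q + 1) / (q + 1) := div_pos (Real.rpow_pos_of_pos hwr _) (by linarith)
    have : 0 < α * w r ^ 2 / 2 := by positivity
    simp only [hE, pohozaev, Real.rpow_zero, zero_mul, sub_zero]
    linarith
  have h3 := (div_le_iff₀ hpp).1 (h2.trans h1)
  have h4 := Real.rpow_le_rpow (by positivity) h3 (show 0 ≤ 1 / (p / (p - 1)) by positivity)
  rwa [← Real.rpow_mul hψ.le, mul_one_div_cancel hpp.ne', Real.rpow_one] at h4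

/-- A positive global solution whose Pohozaev energy decreases behaves like a positive multiple of
`r ^ (-α)` at infinity. -/
theorem slow_decay_of_pohozaev {n p q α l σ a : ℝ} {w ψ : ℝ → ℝ} (hp : 1 < p) (hq : 1 < q)
    (hα : 0 < α) (ha : 0 < a) (hn : 1 ≤ n) (hnl : n ≤ l) (hσ : 0 < σ)
    (h1 : l / (p / (p - 1)) ≤ n - 1 - σ) (h2 : l / (q + 1) ≤ σ)
    (h3 : 0 ≤ (2 * σ - l) * (2 * α - l))
    (h4 : 2 < p ∨ (p < 2 ∧ l * (2 - p) < 2 * p) ∨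
      (p < 2 ∧ α < p / (2 - p) ∧ p / (2 - p) ≤ n / 2 ∧ l = n ∧ σ = n / 2))
    (cw : ContinuousOn w (Ici 0)) (w0 : w 0 = a) (cψ : ContinuousOn ψ (Ici 0)) (ψ0 : ψ 0 = 0)
    (hf : ∀ R, (∀ r ∈ Ico 0 R, 0 < w r) → ∀ r ∈ Ioo 0 R, 0 < ψ r ∧
      HasDerivAt w (-(ψ r) ^ (1 / (p - 1))) r ∧
      HasDerivAt ψ (α * w r + w r ^ q - r * ψ r ^ (1 / (p - 1)) - (n - 1) / r * ψ r) r) :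
    (∀ r ∈ Ici (0 : ℝ), 0 < w r) ∧
    ∃ L : ℝ, 0 < L ∧ Tendsto (fun r => r ^ α * w r) atTop (𝓝 L) := by
  have hpos := pos_of_pohozaev hp hq ha hn hnl hσ h1 h2 h3 cw w0 cψ ψ0 hf
  refine ⟨hpos, ?_⟩
  have hw : ∀ r, 0 < r → 0 < w r := fun r hr => hpos r hr.le
  have hf' := fun r (hr : 0 < r) =>
    hf (r + 1) (fun y hy => hpos y hy.1) r ⟨hr, lt_add_one r⟩
  have hneg := fun R => pohozaev_neg (R := R) hp hq ha hn hnl hσ h1 h2 h3 cw w0 cψ ψ0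
    (fun r hr => hpos r hr.1) (hf R fun r hr => hpos r hr.1)
  have hL := logFlow_of_flux hp hw hf'
  have hpe := fun t => pohozaev_exp (q := q) (l := l) (σ := σ) (e := α + σ - l) hp
    (hw _ (Real.exp_pos t)) (hf' _ (Real.exp_pos t)).1
  have hψw : ∀ t, ψ (Real.exp t) / (Real.exp t * w (Real.exp t)) * w (Real.exp t)
      = ψ (Real.exp t) * Real.exp (-t) := fun t => by
    have := (hw _ (Real.exp_pos t)).ne'
    rw [Real.exp_neg]; field_simp
  obtain ⟨M, hM⟩ := exists_flux_bound hp hq hα hn hw hf'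
  set x := fun t => w (Real.exp t) with hx
  set s := fun t => ψ (Real.exp t) / (Real.exp t * w (Real.exp t)) with hs
  set k := fun t => Real.exp t * ψ (Real.exp t) ^ (1 / (p - 1)) / w (Real.exp t) with hk
  obtain ⟨c, hc, hW⟩ : ∃ c > 0, ∀ t, 0 ≤ t → c ≤ Real.exp (l * t) * x t ^ 2 *
      (s t * (σ - k t / (p / (p - 1))) - (α + σ - l) / 2 - x t ^ (q - 1) / (q + 1)) := by
    refine ⟨-pohozaev p q l σ (α + σ - l) w ψ 1,
      neg_pos.2 ((hneg 1).2 1 ⟨one_pos, le_rfl⟩), fun t ht => ?_⟩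
    have ht1 : 1 ≤ Real.exp t := Real.one_le_exp ht
    have := (hneg (Real.exp t)).1 ⟨zero_le_one, ht1⟩ ⟨(Real.exp_pos t).le, le_rfl⟩ ht1
    rw [hpe t] at this
    linarith
  obtain ⟨K, hK⟩ := hL.k_bounded hp hq hα (by linarith) hσ fun t ht =>
    pos_of_mul_pos_right (hc.trans_le (hW t ht)) (by positivity)
  obtain ⟨C, ε, T, hε, hdecay⟩ : ∃ C ε T : ℝ, 0 < ε ∧ ∀ t, T ≤ t → s t ≤ C * Real.exp (-ε * t) := by
    rcases h4 with h4 | ⟨h4, h5⟩ | ⟨h4, h5, h6, rfl, rfl⟩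
    · exact hL.s_decay_of_two_lt h4 hK
    · exact hL.s_decay_of_lt_two hp h4 hq hσ h5 hc hK hW
    · have hp0 : 0 < p - 1 := by linarith
      have hxz : Tendsto x atTop (𝓝 0) := hL.tendsto_x_zero hα (by linarith) (M := M) fun t ht => by
        simp only [hs, hx, hψw t]
        exact mul_le_mul_of_nonneg_right (hM _ (Real.one_le_exp ht)) (Real.exp_pos _).le
      refine hL.s_decay_of_critical hp h4 hq h5 h6 ?_ hα hxz hc fun t ht => ?_
      · have := (div_le_div_iff₀ (show 0 < 2 - p by linarith) two_pos).1 h6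
        rw [div_mul_eq_mul_div, div_le_div_iff_of_pos_right hp0]
        linarith
      · have := hW t ht
        rwa [show α + l / 2 - l = α - l / 2 by ring] at this
  obtain ⟨L, hL0, hlim⟩ := hL.exists_tendsto hq hα (by linarith) hε hdecay
  refine ⟨L, hL0, (hlim.comp Real.tendsto_log_atTop).congr' ?_⟩
  filter_upwards [eventually_gt_atTop 0] with r hr
  simp only [hx, Function.comp_apply, Real.exp_log hr, Real.rpow_def_of_pos hr]
  rw [mul_comm α]

/-- Assume (L) together with: (i) `p₂ < p`, `α ≤ N/2` and `q ≥ q*`; or (ii) `p ≤ p₂`;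
or (iii) `p₂ < p`, `N/2 < α < (N-1)p'/2` and `q ≥ q*_α` where
`1/(q*_α+1) = (N-1)/(2α) - 1/p'` (`p' = p/(p-1)`). Then every global solution
`w(·,a)`, `a > 0`, is positive on `[0,∞)` and `L(a) > 0`. -/
theorem stmt16 (N : ℕ) (hN : 1 ≤ N) (p q α : ℝ) (hp : 1 < p) (hq : 1 < q) (hα : 0 < α)
    (hL : 2 < p ∨ (p < 2 ∧ α < p / (2 - p)))
    (h : (2 * (N : ℝ) / (N + 2) < p ∧ α ≤ (N : ℝ) / 2 ∧ p < (N : ℝ) ∧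
            ((N : ℝ) * (p - 1) + p) / ((N : ℝ) - p) ≤ q) ∨
         (p ≤ 2 * (N : ℝ) / (N + 2)) ∨
         (2 * (N : ℝ) / (N + 2) < p ∧ (N : ℝ) / 2 < α ∧
            α < ((N : ℝ) - 1) * (p / (p - 1)) / 2 ∧
            1 / (q + 1) ≤ ((N : ℝ) - 1) / (2 * α) - (p - 1) / p))
    (a : ℝ) (ha : 0 < a) (w : ℝ → ℝ) (hw : IsGlobalSolution N p q α a w) :
    (∀ r ∈ Ici (0 : ℝ), 0 < w r) ∧
    ∃ L : ℝ, 0 < L ∧ Tendsto (fun r => r ^ α * w r) atTop (𝓝 L) := by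
  have hn : (1 : ℝ) ≤ N := by exact_mod_cast hN
  have hp0 : 0 < p - 1 := by linarith
  have hq0 : 0 < q + 1 := by linarith
  have hN2 : (0 : ℝ) < N + 2 := by linarith
  have hdiv : ∀ l : ℝ, l / (p / (p - 1)) = l * ((p - 1) / p) := fun l => by
    field_simp
  obtain ⟨ψ, cw, w0, cψ, ψ0, hf⟩ := hw.exists_flux hN hp hq hα ha
  rcases h with ⟨hp2, hαN, hpN, hqs⟩ | hp2 | ⟨hp2, hαN, hα2, hqs⟩
  · have hNp : 0 < (N : ℝ) - p := by linarith
    have hp2' := (div_lt_iff₀ hN2).1 hp2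
    refine slow_decay_of_pohozaev (l := N) (σ := (N - p) / p) hp hq hα ha hn le_rfl
      (by positivity) ?_ ?_ ?_ ?_ cw w0 cψ ψ0 hf
    · rw [hdiv]
      refine le_of_eq ?_
      field_simp
      ring
    · rw [div_le_div_iff₀ hq0 (by linarith)]
      have := (div_le_iff₀ hNp).1 hqs
      linarith
    · refine mul_nonneg_of_nonpos_of_nonpos ?_ (by linarith)
      have : 2 * (((N : ℝ) - p) / p) - N = (2 * N - p * (N + 2)) / p := by field_simp; ring
      rw [this]
      exact div_nonpos_of_nonpos_of_nonneg (by linarith) (by linarith)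
    · exact hL.imp_right fun h2 => Or.inl ⟨h2.1, by linarith⟩
  · have hp2' := (le_div_iff₀ hN2).1 hp2
    have hlt : p < 2 := by
      by_contra! hge
      nlinarith
    have hδ : p / (2 - p) ≤ (N : ℝ) / 2 := by
      rw [div_le_div_iff₀ (by linarith) two_pos]; linarith
    have hαδ : α < p / (2 - p) := by
      rcases hL with h2 | h2
      · linarith
      · exact h2.2
    refine slow_decay_of_pohozaev (l := N) (σ := N / 2) hp hq hα ha hn le_rfl
      (by positivity) ?_ ?_ ?_ (Or.inr (Or.inr ⟨hlt, hαδ, hδ, rfl, rfl⟩)) cw w0 cψ ψ0 hf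
    · rw [hdiv, ← mul_div_assoc, div_le_iff₀ (by linarith)]
      linarith
    · exact div_le_div_of_nonneg_left (by linarith) two_pos (by linarith)
    · rw [show 2 * ((N : ℝ) / 2) - N = 0 by ring, zero_mul]
  · have hσ : 0 < (N : ℝ) - 1 - 2 * α * ((p - 1) / p) := by
      have e1 : 2 * α * ((p - 1) / p) < (N - 1) * (p / (p - 1)) * ((p - 1) / p) :=
        mul_lt_mul_of_pos_right (by linarith) (by positivity)
      have e2 : ((N : ℝ) - 1) * (p / (p - 1)) * ((p - 1) / p) = N - 1 := by field_simp
      linarith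
    refine slow_decay_of_pohozaev (l := 2 * α) (σ := N - 1 - 2 * α * ((p - 1) / p)) hp hq hα ha hn
      (by linarith) hσ ?_ ?_ ?_ ?_ cw w0 cψ ψ0 hf
    · rw [hdiv]; linarith
    · have e1 := mul_le_mul_of_nonneg_left hqs (show 0 ≤ 2 * α by positivity)
      have e2 : 2 * α * (((N : ℝ) - 1) / (2 * α) - (p - 1) / p) = N - 1 - 2 * α * ((p - 1) / p) := by
        field_simp
      rw [e2] at e1
      rwa [mul_one_div] at e1
    · rw [sub_self, mul_zero]
    · refine hL.imp_right fun h2 => Or.inl ⟨h2.1, ?_⟩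
      have := (lt_div_iff₀ (by linarith)).1 h2.2
      linarith
end
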